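/- arXiv:1705.05319 — 6 statements merged into one kernel-verified Lean document; each statement's English description precedes it below -/
import Mathlib

section
/- Let B₃ denote the 8-element Boolean lattice of all subsets of a three-element set. Let L be a finite lattice and let φ be an order isomorphism from Con L to B₃. Then the set B₃ \ φ(Princ L) has at most one element. -/
/-- A congruence of a lattice: an equivalence relation compatible with `⊔` and `⊓`. -/
structure LatCon (L : Type*) [Lattice L] where
  r : L → L → Prop
  refl : ∀ a, r a a
  symm : ∀ {a b}, r a b → r b a
  trans : ∀ {a b c}, r a b → r b c → r a c
  sup_comp : ∀ {a b c d}, r a b → r c d → r (a ⊔ c) (b ⊔ d)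
  inf_comp : ∀ {a b c d}, r a b → r c d → r (a ⊓ c) (b ⊓ d)

namespace LatCon

variable {L : Type*} [Lattice L]

theorem ext' {θ ψ : LatCon L} (h : ∀ a b, θ.r a b ↔ ψ.r a b) : θ = ψ := by
  cases θ; cases ψ
  simp only [mk.injEq]
  funext a b
  exact propext (h a b)

/-- Congruences are ordered by containment. -/
instance : PartialOrder (LatCon L) where
  le θ ψ := ∀ a b, θ.r a b → ψ.r a b
  le_refl θ := fun _ _ h => h
  le_trans θ ψ χ h1 h2 := fun a b h => h2 a b (h1 a b h)
  le_antisymm θ ψ h1 h2 := ext' fun a b => ⟨h1 a b, h2 a b⟩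

instance : InfSet (LatCon L) where
  sInf S :=
    { r := fun a b => ∀ θ ∈ S, θ.r a b
      refl := fun a θ _ => θ.refl a
      symm := fun h θ hθ => θ.symm (h θ hθ)
      trans := fun h1 h2 θ hθ => θ.trans (h1 θ hθ) (h2 θ hθ)
      sup_comp := fun h1 h2 θ hθ => θ.sup_comp (h1 θ hθ) (h2 θ hθ)
      inf_comp := fun h1 h2 θ hθ => θ.inf_comp (h1 θ hθ) (h2 θ hθ) }

/-- `Con L`, the lattice of congruences of `L`, is a complete lattice. -/
instance : CompleteLattice (LatCon L) :=
  completeLatticeOfInf (LatCon L) fun S =>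
    ⟨fun θ hθ a b h => h θ hθ, fun ψ hψ a b h θ hθ => hψ hθ a b h⟩

/-- The principal congruence `con(a, b)`: the smallest congruence collapsing `a` and `b`. -/
def princ (a b : L) : LatCon L := sInf {θ : LatCon L | θ.r a b}

/-- A congruence is principal if it is of the form `con(a, b)`. -/
def IsPrincipal (θ : LatCon L) : Prop := ∃ a b : L, θ = princ a b

end LatCon

/-- `Princ L`, the set of principal congruences of a lattice `L`,
ordered by containment (the order inherited from `Con L`). -/
def Princ (L : Type*) [Lattice L] : Set (LatCon L) := {θ : LatCon L | θ.IsPrincipal}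

/-- `J⁺(D) = {⊥, ⊤} ∪ J(D)`, where `J(D)` is the set of join-irreducible elements. -/
def Jplus (D : Type*) [Lattice D] [BoundedOrder D] : Set D :=
  {⊥, ⊤} ∪ {x : D | SupIrred x}

/-- `Q ⊆ D` is principal congruence representable: there are a finite lattice `L` and
an order isomorphism `φ : Con L ≃o D` mapping `Princ L` exactly onto `Q`. -/
def Representable (D : Type*) [Lattice D] (Q : Set D) : Prop :=
  ∃ (L : Type) (_ : Lattice L) (_ : Fintype L) (φ : LatCon L ≃o D),
    φ '' Princ L = Q

/-- `D` is fully representable: every candidate `J⁺(D) ⊆ Q ⊆ D` is representable. -/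
def FullyRepresentable (D : Type*) [Lattice D] [BoundedOrder D] : Prop :=
  ∀ Q : Set D, Jplus D ⊆ Q → Representable D Q

universe u

namespace LatCon

variable {L : Type*} [Lattice L]

theorem princ_le_iff {a b : L} {θ : LatCon L} : princ a b ≤ θ ↔ θ.r a b :=
  ⟨fun h => h a b fun _ hψ => hψ, fun h => sInf_le h⟩

theorem princ_self (a : L) : princ a a = ⊥ :=
  le_bot_iff.1 (princ_le_iff.2 (refl _ a))

theorem eq_of_bot_r {a b : L} (h : (⊥ : LatCon L).r a b) : a = b :=
  (bot_le : (⊥ : LatCon L) ≤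
    { r := Eq
      refl := fun _ => rfl
      symm := Eq.symm
      trans := Eq.trans
      sup_comp := by rintro _ _ _ _ rfl rfl; rfl
      inf_comp := by rintro _ _ _ _ rfl rfl; rfl }) a b h

theorem princ_eq_bot_iff {a b : L} : princ a b = ⊥ ↔ a = b := by
  refine ⟨fun h => eq_of_bot_r (princ_le_iff.1 h.le), ?_⟩
  rintro rfl
  exact princ_self a

theorem r_of_mem_Icc (θ : LatCon L) {x y a b : L} (h : θ.r x y)
    (hxa : x ≤ a) (hay : a ≤ y) (hxb : x ≤ b) (hby : b ≤ y) : θ.r a b := by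
  have key : ∀ c, x ≤ c → c ≤ y → θ.r c y := fun c hxc hcy => by
    simpa [sup_eq_right.2 hxc, sup_eq_left.2 hcy] using θ.sup_comp h (θ.refl c)
  exact θ.trans (key a hxa hay) (θ.symm (key b hxb hby))

theorem princ_sup_princ {x y z : L} (hxy : x ≤ y) (hyz : y ≤ z) :
    princ x y ⊔ princ y z = princ x z := by
  have h : (princ x z).r x z := princ_le_iff.1 le_rfl
  refine le_antisymm (sup_le ?_ ?_) ?_
  · exact princ_le_iff.2 (r_of_mem_Icc _ h le_rfl (hxy.trans hyz) hxy hyz)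
  · exact princ_le_iff.2 (r_of_mem_Icc _ h hxy hyz (hxy.trans hyz) le_rfl)
  · exact princ_le_iff.2 (trans _ (princ_le_iff.1 le_sup_left) (princ_le_iff.1 le_sup_right))

theorem princ_bot_top [BoundedOrder L] : princ (⊥ : L) ⊤ = ⊤ :=
  top_le_iff.1 fun _ _ _ =>
    r_of_mem_Icc _ (princ_le_iff.1 le_rfl) bot_le le_top bot_le le_top

/-- The join of two congruences, as the transitive closure of their union. -/
def supClosure (α β : LatCon L) : LatCon L where
  r := Relation.ReflTransGen fun a b => α.r a b ∨ β.r a b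
  refl _ := .refl
  symm h := by
    induction h with
    | refl => exact .refl
    | tail _ h ih => exact ih.head (h.imp α.symm β.symm)
  trans := Relation.ReflTransGen.trans
  sup_comp {_ b c _} h₁ h₂ :=
    (h₁.lift (· ⊔ c) fun _ _ => Or.imp (α.sup_comp · (α.refl c)) (β.sup_comp · (β.refl c))).trans
      (h₂.lift (b ⊔ ·) fun _ _ => Or.imp (α.sup_comp (α.refl b)) (β.sup_comp (β.refl b)))
  inf_comp {_ b c _} h₁ h₂ :=
    (h₁.lift (· ⊓ c) fun _ _ => Or.imp (α.inf_comp · (α.refl c)) (β.inf_comp · (β.refl c))).trans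
      (h₂.lift (b ⊓ ·) fun _ _ => Or.imp (α.inf_comp (α.refl b)) (β.inf_comp (β.refl b)))

theorem sup_le_supClosure (α β : LatCon L) : α ⊔ β ≤ supClosure α β :=
  sup_le (fun _ _ h => .single (.inl h)) (fun _ _ h => .single (.inr h))

theorem r_or_r_of_covBy {α β : LatCon L} {x y : L} (hxy : x ⋖ y) (h : (α ⊔ β).r x y) :
    α.r x y ∨ β.r x y := by
  by_contra! hn
  have key : ∀ z, Relation.ReflTransGen (fun a b => α.r a b ∨ β.r a b) x z →
      (z ⊔ x) ⊓ y = x := by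
    intro z hz
    induction hz with
    | refl => simpa using hxy.le
    | @tail b c _ hbc ih =>
      rcases hxy.eq_or_eq (le_inf le_sup_right hxy.le : x ≤ (c ⊔ x) ⊓ y) inf_le_right with hc | hc
      · exact hc
      · have proj : ∀ θ : LatCon L, θ.r b c → θ.r x y := fun θ hθ => by
          have := θ.inf_comp (θ.sup_comp hθ (θ.refl x)) (θ.refl y)
          rwa [ih, hc] at this
        exact (hbc.elim (fun h => hn.1 (proj α h)) (fun h => hn.2 (proj β h))).elim
  have := key y (sup_le_supClosure α β x y h)
  rw [sup_eq_left.2 hxy.le, inf_idem] at this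
  exact hxy.ne' this

theorem princ_supPrime_of_covBy {x y : L} (hxy : x ⋖ y) : SupPrime (princ x y) := by
  refine ⟨fun h => hxy.ne (princ_eq_bot_iff.1 (isMin_iff_eq_bot.1 h)), fun {α β} h => ?_⟩
  simpa only [princ_le_iff] using r_or_r_of_covBy hxy (princ_le_iff.1 h)

theorem exists_map_princ_eq_singleton_of_covBy {ι : Type*} (φ : LatCon L ≃o Set ι) {x y : L}
    (hxy : x ⋖ y) : ∃ i, φ (princ x y) = {i} := by
  have hne : (φ (princ x y)).Nonempty := by
    rw [Set.nonempty_iff_ne_empty, ← Set.bot_eq_empty, Ne, map_eq_bot_iff, princ_eq_bot_iff]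
    exact hxy.ne
  obtain ⟨i, hi⟩ := hne
  refine ⟨i, (Set.singleton_subset_iff.2 hi).antisymm' ?_⟩
  have hle : princ x y ≤ φ.symm {i} ⊔ φ.symm {i}ᶜ := by
    rw [← map_sup, sup_compl_eq_top, map_top]
    exact le_top
  rcases (princ_supPrime_of_covBy hxy).2 hle with h | h
  · exact φ.le_symm_apply.1 h
  · exact absurd rfl (φ.le_symm_apply.1 h hi)

theorem singleton_mem_image_Princ {ι : Type*} (φ : LatCon L ≃o Set ι) (i : ι) :
    {i} ∈ φ '' Princ L := by
  have hne : φ.symm {i} ≠ ⊥ := by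
    rw [Ne, map_eq_bot_iff]
    exact Set.singleton_ne_empty i
  obtain ⟨a, b, hab, h⟩ : ∃ a b, a ≠ b ∧ (φ.symm {i}).r a b := by
    by_contra! hn
    refine hne (le_bot_iff.1 fun a b h => ?_)
    obtain rfl : a = b := by_contra fun hab => hn a b hab h
    exact refl _ a
  refine ⟨princ a b, ⟨a, b, rfl⟩, ?_⟩
  refine (Set.subset_singleton_iff_eq.1 (φ.le_symm_apply.1 (princ_le_iff.2 h))).resolve_left ?_
  rw [← Set.bot_eq_empty, map_eq_bot_iff, princ_eq_bot_iff]
  exact hab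

/-- If no pair `{i, j}` with `j ≠ i` is principal, then the colour `i` cannot be mixed
with other colours in an interval. -/
theorem map_princ_subset_singleton_or_notMem [Finite L] {ι : Type*} (φ : LatCon L ≃o Set ι) {i : ι}
    (hi : ∀ j ≠ i, {i, j} ∉ φ '' Princ L) {x y : L} (hxy : x ≤ y) :
    φ (princ x y) ⊆ {i} ∨ i ∉ φ (princ x y) := by
  have hsup : ∀ {x y z : L}, x ≤ y → y ≤ z →
      φ (princ x z) = φ (princ x y) ∪ φ (princ y z) := fun h₁ h₂ => by
    rw [← princ_sup_princ h₁ h₂, map_sup]; rfl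
  have hmem : ∀ a b : L, φ (princ a b) ∈ φ '' Princ L := fun a b => ⟨_, ⟨a, b, rfl⟩, rfl⟩
  induction y using WellFoundedLT.induction with
  | ind z ih =>
    rcases hxy.eq_or_lt with rfl | hlt
    · left
      simp [princ_self]
    obtain ⟨y, hxy, hyz⟩ := exists_le_covBy_of_lt hlt
    obtain ⟨k, hk⟩ := exists_map_princ_eq_singleton_of_covBy φ hyz
    rw [hsup hxy hyz.le, hk]
    rcases hxy.eq_or_lt with rfl | hlt'
    · simpa [princ_self, eq_comm (a := i)] using em (k = i)
    obtain ⟨w, hxw, hwy⟩ := exists_le_covBy_of_lt hlt'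
    obtain ⟨l, hl⟩ := exists_map_princ_eq_singleton_of_covBy φ hwy
    have hlk : φ (princ w z) = {l, k} := by rw [hsup hwy.le hyz.le, hk, hl]; rfl
    have hly : l ∈ φ (princ x y) := by rw [hsup hxw hwy.le, hl]; simp
    have hiff : l = i ↔ k = i := by
      constructor
      · rintro rfl
        by_contra hne
        exact hi k hne (hlk ▸ hmem w z)
      · rintro rfl
        by_contra hne
        exact hi l hne (Set.pair_comm l k ▸ hlk ▸ hmem w z)
    rcases ih y hyz.lt hxy with h | h
    · exact .inl (Set.union_subset h (Set.singleton_subset_iff.2 (hiff.1 (h hly))))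
    · refine .inr fun hm => hm.elim h fun hik => ?_
      exact h ((hiff.2 (Set.mem_singleton_iff.1 hik).symm) ▸ hly)

end LatCon

theorem exists_pair_eq_or_pair_eq (S T : Finset (Fin 3)) (hST : S ≠ T)
    (hS : S ≠ ∅ ∧ S ≠ Finset.univ ∧ ∀ i, S ≠ {i}) (hT : T ≠ ∅ ∧ T ≠ Finset.univ ∧ ∀ i, T ≠ {i}) :
    ∃ i, ∀ j ≠ i, {i, j} = S ∨ {i, j} = T := by
  revert S T
  decide

/-- **Lemma 11.** If `L` is a finite lattice and `φ : Con L ≃o B₃`, then at most one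
element of `B₃` lies outside the image of `Princ L`. -/
theorem B3_sub_princ_subsingleton
    (L : Type*) [Lattice L] [Fintype L] (φ : LatCon L ≃o Set (Fin 3)) :
    (Set.univ \ (φ '' Princ L)).Subsingleton := by
  classical
  have : Nonempty L := by
    by_contra hL
    rw [not_nonempty_iff] at hL
    exact Set.empty_ne_univ (φ.symm.injective (LatCon.ext' fun a => hL.elim a))
  let _ : BoundedOrder L := Fintype.toBoundedOrder L
  have htop : φ (LatCon.princ ⊥ ⊤) = Set.univ := by rw [LatCon.princ_bot_top, map_top]; rfl
  have proper : ∀ S : Finset (Fin 3), (S : Set (Fin 3)) ∉ φ '' Princ L →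
      S ≠ ∅ ∧ S ≠ Finset.univ ∧ ∀ i, S ≠ {i} := by
    refine fun S hS => ⟨?_, ?_, fun i => ?_⟩ <;> rintro rfl <;> apply hS
    · exact ⟨LatCon.princ ⊥ ⊥, ⟨⊥, ⊥, rfl⟩, by simp [LatCon.princ_self]⟩
    · exact ⟨LatCon.princ ⊥ ⊤, ⟨⊥, ⊤, rfl⟩, by simp [htop]⟩
    · simpa using LatCon.singleton_mem_image_Princ φ i
  rintro S ⟨-, hS⟩ T ⟨-, hT⟩
  lift S to Finset (Fin 3) using S.toFinite
  lift T to Finset (Fin 3) using T.toFinite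
  by_contra hST
  obtain ⟨i, hi⟩ := exists_pair_eq_or_pair_eq S T (fun h => hST (h ▸ rfl))
    (proper S hS) (proper T hT)
  have hpair : ∀ j ≠ i, ({i, j} : Set (Fin 3)) ∉ φ '' Princ L := fun j hj => by
    rw [← Finset.coe_pair]
    rcases hi j hj with h | h <;> rwa [h]
  obtain ⟨j, hj⟩ := exists_ne i
  rcases LatCon.map_princ_subset_singleton_or_notMem φ hpair (bot_le : (⊥ : L) ≤ ⊤)
    with h | h <;> rw [htop] at h
  · exact hj (h (Set.mem_univ j))
  · exact h (Set.mem_univ i)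
end

section
/- Let B₃ denote the 8-element Boolean lattice of all subsets of a three-element set, and let Q be a candidate in B₃, i.e., J⁺(B₃) ⊆ Q ⊆ B₃. Then Q is principal congruence representable if and only if B₃ \ Q has at most one element. -/
universe u

namespace LatCon

variable {L : Type*} [Lattice L]

theorem princ_self_le (a : L) (θ : LatCon L) : princ a a ≤ θ :=
  princ_le_iff.2 (θ.refl a)

theorem eq_of_princ_le_bot {a b : L} (h : princ a b ≤ ⊥) : a = b := by
  let ε : LatCon L :=
    { r := Eq
      refl := fun _ => rfl
      symm := Eq.symm
      trans := Eq.trans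
      sup_comp := by rintro _ _ _ _ rfl rfl; rfl
      inf_comp := by rintro _ _ _ _ rfl rfl; rfl }
  exact princ_le_iff.1 (h.trans (bot_le (a := ε)))

/-- For `a ≤ b ≤ c`, the congruence `con(a, c)` is the join of `con(a, b)` and `con(b, c)`. -/
theorem princ_eq_sup {a b c : L} (hab : a ≤ b) (hbc : b ≤ c) :
    princ a c = princ a b ⊔ princ b c := by
  apply le_antisymm
  · rw [princ_le_iff]
    exact trans _ (princ_le_iff.1 le_sup_left) (princ_le_iff.1 le_sup_right)
  · have h : (princ a c).r a c := princ_le_iff.1 le_rfl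
    refine sup_le (princ_le_iff.2 ?_) (princ_le_iff.2 ?_)
    · have := inf_comp _ h (refl _ b)
      rwa [inf_eq_left.2 hab, inf_eq_right.2 hbc] at this
    · have := sup_comp _ h (refl _ b)
      rwa [sup_eq_right.2 hab, sup_eq_left.2 hbc] at this

/-- The congruence whose classes are connected by finite sequences of steps in `θ` or `ψ`. -/
def joinGen (θ ψ : LatCon L) : LatCon L where
  r := Relation.ReflTransGen fun a b => θ.r a b ∨ ψ.r a b
  refl _ := .refl
  symm h := by
    induction h with
    | refl => exact .refl
    | tail _ h ih => exact .head (h.imp θ.symm ψ.symm) ih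
  trans := .trans
  sup_comp {_ b c _} h₁ h₂ :=
    (h₁.lift (· ⊔ c) fun _ _ h =>
      h.imp (θ.sup_comp · (θ.refl c)) (ψ.sup_comp · (ψ.refl c))).trans
    (h₂.lift (b ⊔ ·) fun _ _ h =>
      h.imp (θ.sup_comp (θ.refl b)) (ψ.sup_comp (ψ.refl b)))
  inf_comp {_ b c _} h₁ h₂ :=
    (h₁.lift (· ⊓ c) fun _ _ h =>
      h.imp (θ.inf_comp · (θ.refl c)) (ψ.inf_comp · (ψ.refl c))).trans
    (h₂.lift (b ⊓ ·) fun _ _ h =>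
      h.imp (θ.inf_comp (θ.refl b)) (ψ.inf_comp (ψ.refl b)))

theorem sup_le_joinGen (θ ψ : LatCon L) : θ ⊔ ψ ≤ joinGen θ ψ :=
  sup_le (fun _ _ h => .single (.inl h)) (fun _ _ h => .single (.inr h))

/-- The principal congruence of a prime interval is join-prime. -/
theorem princ_le_or_le_of_covBy {a b : L} (hab : a ⋖ b) {θ ψ : LatCon L}
    (h : princ a b ≤ θ ⊔ ψ) : princ a b ≤ θ ∨ princ a b ≤ ψ := by
  have hr : Relation.ReflTransGen (fun a b => θ.r a b ∨ ψ.r a b) a b :=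
    princ_le_iff.1 (h.trans (sup_le_joinGen θ ψ))
  simp only [princ_le_iff]
  by_contra hcon
  have key : ∀ x, Relation.ReflTransGen (fun a b => θ.r a b ∨ ψ.r a b) a x →
      (a ⊔ x) ⊓ b = a := by
    intro x hx
    induction hx with
    | refl => simpa using hab.le
    | @tail y z _ hyz ih =>
      have hstep : θ.r a ((a ⊔ z) ⊓ b) ∨ ψ.r a ((a ⊔ z) ⊓ b) := by
        refine hyz.imp (fun h => ?_) (fun h => ?_)
        · have := θ.inf_comp (θ.sup_comp (θ.refl a) h) (θ.refl b)
          rwa [ih] at this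
        · have := ψ.inf_comp (ψ.sup_comp (ψ.refl a) h) (ψ.refl b)
          rwa [ih] at this
      rcases hab.eq_or_eq (le_inf le_sup_left hab.le) (inf_le_right : (a ⊔ z) ⊓ b ≤ b) with h | h
      · exact h
      · rw [h] at hstep
        exact absurd hstep hcon
  have := key b hr
  rw [sup_eq_right.2 hab.le, inf_idem] at this
  exact hab.ne this.symm

/-- If the congruence lattice of a finite lattice is the power set of `ι` and `ι` is nontrivial,
then every `j` belongs to a two-element set that corresponds to a principal congruence. -/
theorem exists_isPrincipal_pair {ι : Type*} [Finite L] [Nonempty L] (φ : LatCon L ≃o Set ι)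
    {j k : ι} (hjk : j ≠ k) :
    ∃ i, i ≠ j ∧ ∃ a b : L, φ (princ a b) = {j, i} := by
  have := Fintype.ofFinite L
  let := Fintype.toBoundedOrder L
  have hsup : ∀ {a b c : L}, a ≤ b → b ≤ c →
      φ (princ a c) = φ (princ a b) ∪ φ (princ b c) := fun hab hbc => by
    rw [princ_eq_sup hab hbc, map_sup]; rfl
  have hcov : ∀ {a b : L}, a ⋖ b → ∃ i, φ (princ a b) = {i} := by
    intro a b hab
    have hne : (φ (princ a b)).Nonempty := by
      rw [Set.nonempty_iff_ne_empty]
      intro h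
      refine hab.ne (eq_of_princ_le_bot ?_)
      rw [← φ.le_iff_le, h]
      exact Set.empty_subset _
    obtain ⟨i, hi⟩ := hne
    refine ⟨i, Set.Subset.antisymm ?_ (Set.singleton_subset_iff.2 hi)⟩
    have : princ a b ≤ φ.symm {i} ⊔ φ.symm {i}ᶜ := by
      rw [← map_sup, ← φ.le_iff_le, φ.apply_symm_apply]
      intro x _
      exact em (x = i)
    rcases princ_le_or_le_of_covBy hab this with h | h
    · exact (φ.le_symm_apply).1 h
    · exact absurd rfl ((φ.le_symm_apply).1 h hi)
  by_contra! hcon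
  have hstep : ∀ {a b c : L}, a ⋖ b → b ⋖ c →
      (φ (princ a b) = {j} ↔ φ (princ b c) = {j}) := by
    intro a b c hab hbc
    obtain ⟨x, hx⟩ := hcov hab
    obtain ⟨y, hy⟩ := hcov hbc
    have h := hsup hab.le hbc.le
    rw [hx, hy] at h ⊢
    simp only [Set.singleton_eq_singleton_iff]
    constructor
    · rintro rfl
      by_contra hne
      exact hcon y hne a c h
    · rintro rfl
      by_contra hne
      exact hcon x hne a c (h.trans (Set.union_comm _ _))
  have hprop : ∀ a p : L, p ⋖ a → (φ (princ p a) = {j} → φ (princ a ⊤) ⊆ {j}) ∧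
      (φ (princ p a) ≠ {j} → φ (princ a ⊤) ⊆ {j}ᶜ) := by
    intro a
    induction a using (wellFounded_gt (α := L)).induction with
    | _ a ih =>
    intro p hpa
    rcases eq_or_lt_of_le (le_top : a ≤ ⊤) with rfl | hlt
    · have : φ (princ ⊤ ⊤) = ⊥ := by
        rw [← map_bot φ, le_bot_iff.1 (princ_self_le _ _)]
      rw [this]
      exact ⟨fun _ => bot_le, fun _ => bot_le⟩
    · obtain ⟨c, hac, hc⟩ := exists_covBy_le_of_lt hlt
      rw [hsup hac.le hc, Ne, hstep hpa hac]
      refine ⟨fun h => Set.union_subset h.subset ((ih c hac.lt a hac).1 h), fun h =>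
        Set.union_subset ?_ ((ih c hac.lt a hac).2 h)⟩
      obtain ⟨x, hx⟩ := hcov hac
      rw [hx] at h ⊢
      rintro _ rfl rfl
      exact h rfl
  have huniv : φ (princ ⊥ ⊤) = Set.univ := by rw [princ_bot_top, map_top]; rfl
  have hbt : (⊥ : L) < ⊤ := by
    refine bot_lt_iff_ne_bot.2 fun h => ?_
    rw [h] at huniv
    have : φ (princ ⊥ ⊥) = ∅ := by
      rw [le_bot_iff.1 (princ_self_le (⊥ : L) ⊥), map_bot]; rfl
    exact Set.notMem_empty j (this ▸ huniv ▸ Set.mem_univ j)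
  obtain ⟨c, hc, hct⟩ := exists_covBy_le_of_lt hbt
  rw [hsup hc.le hct] at huniv
  obtain ⟨x, hx⟩ := hcov hc
  have hall : ∀ i, i = x ∨ i ∈ φ (princ c ⊤) := fun i => by
    have : i ∈ φ (princ ⊥ c) ∪ φ (princ c ⊤) := huniv ▸ Set.mem_univ i
    rwa [hx] at this
  by_cases hxj : x = j
  · subst hxj
    have h := (hprop c ⊥ hc).1 hx
    rcases hall k with h' | h'
    · exact hjk h'.symm
    · exact hjk (h h').symm
  · have h := (hprop c ⊥ hc).2 (by rwa [hx, Ne, Set.singleton_eq_singleton_iff])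
    rcases hall j with h' | h'
    · exact hxj h'.symm
    · exact h h' rfl

section SetRepresentation

variable {ι : Type*}

/-- The congruence of a lattice represented by sets that ignores the points of `s`. -/
def ignore (f : L → Set ι) (hsup : ∀ a b, f (a ⊔ b) = f a ∪ f b)
    (hinf : ∀ a b, f (a ⊓ b) = f a ∩ f b) (s : Set ι) : LatCon L where
  r a b := ∀ i, ¬(i ∈ f a ↔ i ∈ f b) → i ∈ s
  refl a i h := absurd Iff.rfl h
  symm h i hi := h i fun h' => hi h'.symm
  trans h₁ h₂ i hi := by
    have := h₁ i; have := h₂ i; tauto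
  sup_comp {a b c d} h₁ h₂ i hi := by
    have := h₁ i; have := h₂ i
    simp only [hsup, Set.mem_union] at hi; tauto
  inf_comp {a b c d} h₁ h₂ i hi := by
    have := h₁ i; have := h₂ i
    simp only [hinf, Set.mem_inter_iff] at hi; tauto

/-- Let a finite lattice be represented faithfully by subsets of `ι` so that coverings add exactly
one point and each point is added by some interval `[p i, q i]`. Then its congruence lattice is
the power set of `ι`, and `con(a, b)` corresponds to the symmetric difference of `a` and `b`. -/
theorem exists_orderIso_of_representation [Finite L] (f : L → Set ι) (hf : Function.Injective f)
    (hsup : ∀ a b, f (a ⊔ b) = f a ∪ f b) (hinf : ∀ a b, f (a ⊓ b) = f a ∩ f b)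
    (p q : ι → L) (hp : ∀ i, i ∉ f (p i)) (hq : ∀ i, f (q i) = insert i (f (p i)))
    (hcov : ∀ a b, a ⋖ b → ∃ i, f b = insert i (f a)) :
    ∃ φ : LatCon L ≃o Set ι, ∀ a b, φ (princ a b) = {i | ¬(i ∈ f a ↔ i ∈ f b)} := by
  have hup : ∀ (θ : LatCon L) (a b : L) (i : ι), θ.r a b → i ∉ f a → i ∈ f b →
      θ.r (p i) (q i) := by
    intro θ a b i h ha hb
    have h' := θ.sup_comp (θ.refl (p i)) (θ.inf_comp (θ.refl (q i)) h)
    have h₁ : p i ⊔ q i ⊓ a = p i := hf (by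
      rw [hsup, hinf, hq]; ext x
      simp only [Set.mem_union, Set.mem_inter_iff, Set.mem_insert_iff]
      by_cases hx : x = i
      · subst hx; tauto
      · tauto)
    have h₂ : p i ⊔ q i ⊓ b = q i := hf (by
      rw [hsup, hinf, hq]; ext x
      simp only [Set.mem_union, Set.mem_inter_iff, Set.mem_insert_iff]
      by_cases hx : x = i
      · subst hx; tauto
      · tauto)
    rwa [h₁, h₂] at h'
  have hdiff : ∀ (θ : LatCon L) (a b : L) (i : ι), θ.r a b → ¬(i ∈ f a ↔ i ∈ f b) →
      θ.r (p i) (q i) := by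
    intro θ a b i h hi
    by_cases ha : i ∈ f a
    · exact hup θ b a i (θ.symm h) (by tauto) ha
    · exact hup θ a b i h ha (by tauto)
  have hdown : ∀ (θ : LatCon L) (a b : L) (i : ι), θ.r (p i) (q i) → f b = insert i (f a) →
      θ.r a b := by
    intro θ a b i h hb
    have h' := θ.sup_comp (θ.refl a) (θ.inf_comp (θ.refl b) h)
    have hpi := hp i
    have h₁ : a ⊔ b ⊓ p i = a := hf (by
      rw [hsup, hinf, hb]; ext x
      simp only [Set.mem_union, Set.mem_inter_iff, Set.mem_insert_iff]
      by_cases hx : x = i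
      · subst hx; tauto
      · tauto)
    have h₂ : a ⊔ b ⊓ q i = b := hf (by
      rw [hsup, hinf, hq, hb]; ext x
      simp only [Set.mem_union, Set.mem_inter_iff, Set.mem_insert_iff]
      by_cases hx : x = i
      · subst hx; tauto
      · tauto)
    rwa [h₁, h₂] at h'
  have hmono : ∀ {a b : L}, a ≤ b → f a ⊆ f b := fun {a b} h => by
    rw [← sup_eq_right.2 h, hsup]; exact Set.subset_union_left
  have hle : ∀ (θ : LatCon L) (b a : L), a ≤ b →
      (∀ i, i ∉ f a → i ∈ f b → θ.r (p i) (q i)) → θ.r a b := by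
    intro θ b a
    induction a using (wellFounded_gt (α := L)).induction with
    | _ a ih =>
    intro hab h
    rcases hab.eq_or_lt with rfl | hlt
    · exact θ.refl _
    · obtain ⟨c, hac, hcb⟩ := exists_covBy_le_of_lt hlt
      obtain ⟨i, hi⟩ := hcov a c hac
      refine θ.trans (hdown θ a c i (h i (fun hia => ?_) ?_) hi)
        (ih c hac.lt hcb fun k hk => h k fun hka => hk (hmono hac.le hka))
      · exact hac.ne (hf (by rw [hi, Set.insert_eq_of_mem hia]))
      · exact hmono hcb (hi ▸ Set.mem_insert i _)
  have hrec : ∀ (θ : LatCon L) (a b : L),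
      (∀ i, ¬(i ∈ f a ↔ i ∈ f b) → θ.r (p i) (q i)) → θ.r a b := by
    intro θ a b h
    refine θ.trans (b := a ⊓ b) (θ.symm (hle θ a _ inf_le_left fun i hi hia => h i ?_))
      (hle θ b _ inf_le_right fun i hi hib => h i ?_)
    all_goals
      simp only [hinf, Set.mem_inter_iff] at hi
      tauto
  let φ : LatCon L ≃o Set ι :=
    { toFun := fun θ => {i | θ.r (p i) (q i)}
      invFun := ignore f hsup hinf
      left_inv := fun θ => ext' fun a b => ⟨hrec θ a b, fun h i hi => hdiff θ a b i h hi⟩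
      right_inv := fun s => by
        ext i
        have hpi := hp i
        constructor
        · intro h
          exact h i (by rw [hq]; simp [hpi])
        · intro his x hx
          rw [hq] at hx
          simp only [Set.mem_insert_iff] at hx
          by_cases hxi : x = i
          · exact hxi ▸ his
          · tauto
      map_rel_iff' := fun {θ ψ} =>
        ⟨fun h a b hab => hrec ψ a b fun i hi => h (hdiff θ a b i hab hi),
          fun h i hi => h _ _ hi⟩ }
  refine ⟨φ, fun a b => Set.Subset.antisymm ?_ ?_⟩
  · refine (φ.le_symm_apply).1 (princ_le_iff.2 ?_)
    exact fun i hi => hi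
  · exact fun i hi => hdiff _ a b i (princ_le_iff.1 le_rfl) hi

end SetRepresentation

end LatCon

/-- The full power set of a finite set is principal congruence representable. -/
theorem representable_univ {ι : Type} [Finite ι] : Representable (Set ι) Set.univ := by
  have := Fintype.ofFinite (Set ι)
  obtain ⟨φ, hφ⟩ := LatCon.exists_orderIso_of_representation (L := Set ι) id
    Function.injective_id (fun _ _ => rfl) (fun _ _ => rfl) (fun _ => ∅) (fun i => {i})
    (fun _ => Set.notMem_empty _) (fun i => by simp) fun a b hab => by
      obtain ⟨i, -, hi⟩ := Set.covBy_iff_exists_insert.1 hab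
      exact ⟨i, hi.symm⟩
  refine ⟨Set ι, inferInstance, inferInstance, φ, Set.eq_univ_of_forall fun s => ?_⟩
  refine ⟨_, ⟨∅, s, rfl⟩, ?_⟩
  rw [hφ]
  ext i
  simp

/-- The coatom `{i}ᶜ` is the only set missing from the principal congruences of a chain of
length three whose middle prime interval has colour `i`. -/
theorem representable_compl_coatom (i : Fin 3) :
    Representable (Set (Fin 3)) {{i}ᶜ}ᶜ := by
  let σ : Equiv.Perm (Fin 3) := Equiv.swap 1 i
  have hσ : ∀ x, σ x = 1 ↔ x = i := fun x => by
    rw [← σ.injective.eq_iff (a := x) (b := i)]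
    simp [σ]
  obtain ⟨φ, hφ⟩ := LatCon.exists_orderIso_of_representation (L := Fin 4) (ι := Fin 3)
    (fun a => {x | (σ x).castSucc < a})
    (fun a b h => by
      have key : ∀ a b : Fin 4, (∀ y : Fin 3, y.castSucc < a ↔ y.castSucc < b) → a = b := by
        decide
      refine key a b fun y => ?_
      have := Set.ext_iff.1 h (σ.symm y)
      simpa using this)
    (fun a b => by ext x; simp [lt_sup_iff])
    (fun a b => by ext x; simp [lt_inf_iff])
    (fun x => (σ x).castSucc) (fun x => (σ x).succ)
    (fun x => by simp)
    (fun x => by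
      have key : ∀ y z : Fin 3, y.castSucc < z.succ ↔ y = z ∨ y.castSucc < z.castSucc := by
        decide
      ext y
      simp only [Set.mem_ofPred_eq, Set.mem_insert_iff, key, σ.injective.eq_iff])
    (fun a b hab => by
      have key : ∀ a b : Fin 4, a < b → (∀ c, a < c → ¬ c < b) →
          ∃ z : Fin 3, ∀ y : Fin 3, y.castSucc < b ↔ y = z ∨ y.castSucc < a := by
        decide
      obtain ⟨z, hz⟩ := key a b hab.1 fun c h => hab.2 h
      refine ⟨σ.symm z, ?_⟩
      ext y
      simp only [Set.mem_ofPred_eq, Set.mem_insert_iff, hz, Equiv.eq_symm_apply])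
  refine ⟨Fin 4, inferInstance, inferInstance, φ, ?_⟩
  have key : ∀ g : Fin 3 → Bool, (∃ a b : Fin 4, ∀ y : Fin 3,
      ¬(y.castSucc < a ↔ y.castSucc < b) ↔ g y = true) ↔ ¬ ∀ y, g y = true ↔ y ≠ 1 := by
    decide
  classical
  ext s
  have hs := key fun y => decide (σ.symm y ∈ s)
  simp only [decide_eq_true_eq] at hs
  rw [Set.mem_compl_iff, Set.mem_singleton_iff]
  have hR : s = {i}ᶜ ↔ ∀ y, σ.symm y ∈ s ↔ y ≠ 1 := by
    rw [Set.ext_iff, ← σ.symm.forall_congr_right]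
    simp [← hσ]
  rw [hR, ← hs]
  constructor
  · rintro ⟨_, ⟨a, b, rfl⟩, rfl⟩
    refine ⟨a, b, fun y => ?_⟩
    simp [hφ]
  · rintro ⟨a, b, h⟩
    refine ⟨_, ⟨a, b, rfl⟩, ?_⟩
    rw [hφ]
    ext x
    simpa using h (σ x)

/-- The only elements of `Set (Fin 3)` outside `Jplus` are coatoms. -/
theorem eq_compl_singleton_of_notMem_Jplus {s : Set (Fin 3)} (hs : s ∉ Jplus (Set (Fin 3))) :
    ∃ i, s = {i}ᶜ := by
  classical
  have key : ∀ g : Fin 3 → Bool, (∀ y, g y = false) ∨ (∀ y, g y = true) ∨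
      (∃ i, ∀ y, g y = true ↔ y = i) ∨ ∃ i, ∀ y, g y = true ↔ y ≠ i := by decide
  rcases key fun y => decide (y ∈ s) with h | h | ⟨i, h⟩ | ⟨i, h⟩ <;>
    simp only [decide_eq_true_eq, decide_eq_false_iff_not] at h
  · exact absurd (Or.inl (Or.inl (Set.eq_empty_of_forall_notMem h))) hs
  · exact absurd (Or.inl (Or.inr (Set.eq_univ_of_forall h))) hs
  · refine absurd (Or.inr ?_) hs
    obtain rfl : s = {i} := Set.ext h
    refine ⟨fun hmin => ?_, fun b c hbc => ?_⟩
    · exact hmin (Set.empty_subset _) rfl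
    · change b ∪ c = {i} at hbc
      have hi : i ∈ b ∪ c := hbc ▸ Set.mem_singleton i
      refine hi.imp (fun hi => ?_) (fun hi => ?_)
      · exact (hbc ▸ Set.subset_union_left : b ⊆ {i}).antisymm (Set.singleton_subset_iff.2 hi)
      · exact (hbc ▸ Set.subset_union_right : c ⊆ {i}).antisymm (Set.singleton_subset_iff.2 hi)
  · exact ⟨i, Set.ext h⟩

/-- **Theorem 12.** A candidate `Q` in the eight-element Boolean lattice
`B₃ = Set (Fin 3)` is representable iff `|B₃ \ Q| ≤ 1`. -/
theorem B3_candidate_representable_iff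
    (Q : Set (Set (Fin 3))) (hQ : Jplus (Set (Fin 3)) ⊆ Q) :
    Representable (Set (Fin 3)) Q ↔ (Set.univ \ Q).Subsingleton := by
  constructor
  · rintro ⟨L, _, _, φ, rfl⟩ s hs t ht
    obtain ⟨k, rfl⟩ := eq_compl_singleton_of_notMem_Jplus fun h => hs.2 (hQ h)
    obtain ⟨l, rfl⟩ := eq_compl_singleton_of_notMem_Jplus fun h => ht.2 (hQ h)
    by_contra hne
    have hkl : k ≠ l := fun h => hne (by rw [h])
    have : Nonempty L := by
      by_contra hL
      rw [not_nonempty_iff] at hL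
      have : Subsingleton (LatCon L) := ⟨fun _ _ => LatCon.ext' fun a => isEmptyElim a⟩
      exact hne (φ.symm.injective (Subsingleton.elim _ _))
    have key : ∀ k l : Fin 3, k ≠ l → ∃ j, j ≠ k ∧ ∀ i, i ≠ j →
        (∀ x, x = j ∨ x = i ↔ x ≠ k) ∨ ∀ x, x = j ∨ x = i ↔ x ≠ l := by decide
    obtain ⟨j, hjk, hj⟩ := key k l hkl
    obtain ⟨i, hij, a, b, hab⟩ := LatCon.exists_isPrincipal_pair φ hjk
    rcases hj i hij with h | h
    · exact hs.2 ⟨_, ⟨a, b, rfl⟩, hab.trans (Set.ext h)⟩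
    · exact ht.2 ⟨_, ⟨a, b, rfl⟩, hab.trans (Set.ext h)⟩
  · intro h
    rcases Set.eq_empty_or_nonempty (Set.univ \ Q) with h0 | ⟨s, hs⟩
    · rw [Set.univ_subset_iff.1 (Set.sdiff_eq_empty.1 h0)]
      exact representable_univ
    · obtain ⟨i, rfl⟩ := eq_compl_singleton_of_notMem_Jplus fun hJ => hs.2 (hQ hJ)
      have hQ' : Q = {{i}ᶜ}ᶜ := by
        rw [← compl_compl Q, Set.compl_eq_univ_sdiff Q,
          h.eq_singleton_of_mem hs]
      rw [hQ']
      exact representable_compl_coatom i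
end

section
/- The 8-element Boolean lattice B₃ of all subsets of a three-element set is not fully representable; together with the full representability of all distributive lattices of at most 7 elements, this shows that the smallest finite distributive lattice that is not fully representable has 8 elements. -/
universe u

namespace LatCon

section Basic

variable {L : Type*} [Lattice L]

theorem princ_rel (a b : L) : (princ a b).r a b := fun _ h => h

theorem rel_inf_sup {θ : LatCon L} {a b : L} (h : θ.r a b) : θ.r (a ⊓ b) (a ⊔ b) := by
  have h₁ : θ.r (a ⊓ b) b := by simpa using θ.inf_comp h (θ.refl b)
  have h₂ : θ.r (a ⊔ b) b := by simpa using θ.sup_comp h (θ.refl b)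
  exact θ.trans h₁ (θ.symm h₂)

theorem rel_of_rel_inf_sup {θ : LatCon L} {a b : L} (h : θ.r (a ⊓ b) (a ⊔ b)) : θ.r a b := by
  have h₁ : θ.r a (a ⊔ b) := by simpa using θ.sup_comp (θ.refl a) h
  have h₂ : θ.r b (a ⊔ b) := by simpa using θ.sup_comp (θ.refl b) h
  exact θ.trans h₁ (θ.symm h₂)

theorem rel_of_le {θ : LatCon L} {a b u v : L} (h : θ.r a b) (hau : a ≤ u) (huv : u ≤ v)
    (hvb : v ≤ b) : θ.r u v := by
  have h₁ : θ.r u b := by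
    simpa [hau, huv.trans hvb] using θ.sup_comp (θ.refl u) h
  simpa [huv, hvb] using θ.inf_comp h₁ (θ.refl v)

/-- An equivalence relation compatible with joining and meeting with a fixed element is a
congruence. -/
def ofUnary (r : L → L → Prop) (refl : ∀ a, r a a) (symm : ∀ a b, r a b → r b a)
    (trans : ∀ a b c, r a b → r b c → r a c) (sup : ∀ a b c, r a b → r (a ⊔ c) (b ⊔ c))
    (inf : ∀ a b c, r a b → r (a ⊓ c) (b ⊓ c)) : LatCon L where
  r := r
  refl := refl
  symm h := symm _ _ h
  trans h₁ h₂ := trans _ _ _ h₁ h₂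
  sup_comp {a b c d} h₁ h₂ := trans _ _ _ (sup a b c h₁) <| by
    simpa only [sup_comm b] using sup c d b h₂
  inf_comp {a b c d} h₁ h₂ := trans _ _ _ (inf a b c h₁) <| by
    simpa only [inf_comm b] using inf c d b h₂

end Basic

/-- If `κ e` collapses exactly the pairs at distance at most `e`, and `κ` is a bijection onto
the congruences, then the set of distances is representable. -/
theorem representable_range {D : Type*} [Lattice D] {L : Type} [Lattice L] [Fintype L]
    (d : L → L → D) (κ : D → LatCon L) (hκ : ∀ e a b, (κ e).r a b ↔ d a b ≤ e)
    (hle : ∀ e f, (∀ a b, d a b ≤ e → d a b ≤ f) → e ≤ f) (hsurj : ∀ θ, ∃ e, κ e = θ) :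
    Representable D {x | ∃ a b, d a b = x} := by
  have hmono : ∀ {e f}, κ e ≤ κ f ↔ e ≤ f := fun {e f} =>
    ⟨fun h => hle e f fun a b hab => (hκ f a b).1 (h a b ((hκ e a b).2 hab)),
      fun h a b hab => (hκ f a b).2 (((hκ e a b).1 hab).trans h)⟩
  let ψ : D ≃o LatCon L :=
    { Equiv.ofBijective κ ⟨fun e f h => le_antisymm (hmono.1 h.le) (hmono.1 h.ge), hsurj⟩ with
      map_rel_iff' := hmono }
  have hψ : ∀ a b, ψ.symm (princ a b) = d a b := fun a b => by
    rw [OrderIso.symm_apply_eq]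
    refine le_antisymm (princ_le_iff.2 ((hκ _ _ _).2 le_rfl)) fun x y hxy => ?_
    obtain ⟨e, he⟩ := hsurj (princ a b)
    rw [← he, hκ]
    exact ((hκ _ _ _).1 hxy).trans ((hκ _ _ _).1 (he ▸ princ_rel a b))
  refine ⟨L, inferInstance, inferInstance, ψ.symm, ?_⟩
  ext x
  constructor
  · rintro ⟨_, ⟨a, b, rfl⟩, rfl⟩
    exact ⟨a, b, (hψ a b).symm⟩
  · rintro ⟨a, b, rfl⟩
    exact ⟨_, ⟨a, b, rfl⟩, hψ a b⟩

end LatCon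

open LatCon in
/-- A distributive lattice with join-irreducible elements `p j` is represented by a finite lattice
`L` with a family of congruences (the kernels of `lab j`) such that a congruence `θ` of `L` is
determined by the set of those `j` for which it collapses a fixed pair `edge j`. -/
theorem representable_of_labels {D : Type*} [DistribLattice D] [BoundedOrder D] [Finite D]
    {L : Type} [Lattice L] [Fintype L] {m : ℕ} (p : Fin m → D)
    (hp : ∀ x, SupIrred x ↔ ∃ j, p j = x) (lab : Fin m → L → ℕ) (edge : Fin m → L × L)
    (hsup : ∀ j a b c, lab j a = lab j b → lab j (a ⊔ c) = lab j (b ⊔ c))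
    (hinf : ∀ j a b c, lab j a = lab j b → lab j (a ⊓ c) = lab j (b ⊓ c))
    (hedge : ∀ i j, lab i (edge j).1 ≠ lab i (edge j).2 ↔ p i ≤ p j)
    (hsep : ∀ (θ : LatCon L) j a b, θ.r a b → lab j a ≠ lab j b →
      θ.r (edge j).1 (edge j).2)
    (hgen : ∀ (θ : LatCon L) a b, (∀ j, lab j a ≠ lab j b → θ.r (edge j).1 (edge j).2) →
      θ.r a b) :
    Representable D {x | ∃ a b, (Finset.univ.filter fun j => lab j a ≠ lab j b).sup p = x} := by
  classical
  have hd : ∀ (e : D) (a b : L), (Finset.univ.filter fun j => lab j a ≠ lab j b).sup p ≤ e ↔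
      ∀ j, lab j a ≠ lab j b → p j ≤ e := by simp
  refine representable_range
    (fun a b => (Finset.univ.filter fun j => lab j a ≠ lab j b).sup p)
    (fun e => ofUnary (fun a b => ∀ j, lab j a ≠ lab j b → p j ≤ e) ?_ ?_ ?_ ?_ ?_) ?_ ?_ ?_
  · simp
  · exact fun a b h j hj => h j hj.symm
  · intro a b c h₁ h₂ j hj
    by_cases hab : lab j a = lab j b
    · exact h₂ j (hab ▸ hj)
    · exact h₁ j hab
  · exact fun a b c h j hj => h j fun hab => hj (hsup j a b c hab)
  · exact fun a b c h j hj => h j fun hab => hj (hinf j a b c hab)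
  · exact fun e a b => (hd e a b).symm
  · intro e f h
    obtain ⟨s, rfl, hs⟩ := exists_supIrred_decomposition e
    refine Finset.sup_le fun x hx => ?_
    obtain ⟨j, rfl⟩ := (hp x).1 (hs hx)
    have hj := h (edge j).1 (edge j).2
    rw [hd, hd] at hj
    refine hj (fun i hi => ?_) j ((hedge j j).2 le_rfl)
    exact ((hedge i j).1 hi).trans (Finset.le_sup (f := id) hx)
  · intro θ
    refine ⟨(Finset.univ.filter fun j => θ.r (edge j).1 (edge j).2).sup p, ext' fun a b => ?_⟩
    constructor
    · intro h
      refine hgen θ a b fun j hj => ?_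
      have hjp : SupPrime (p j) := ((hp _).2 ⟨j, rfl⟩).supPrime
      obtain ⟨i, hi, hji⟩ := hjp.le_finset_sup.1 (h j hj)
      exact hsep θ j _ _ (Finset.mem_filter.1 hi).2 ((hedge j i).2 hji)
    · intro h j hj
      exact Finset.le_sup (f := p) (Finset.mem_filter.2 ⟨Finset.mem_univ _, hsep θ j a b h hj⟩)

/-- A finite lattice on `Fin (n + 1)` with `m` congruences, given by tables whose rows are written
in base `100` (the least significant digit is the entry with index `0`), together with
certificates for the generation of its congruences. -/
structure LatTable (n m : ℕ) where
  /-- the join table -/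
  join : List ℕ
  /-- the meet table -/
  meet : List ℕ
  /-- row `j` lists the classes of the elements in the `j`-th congruence -/
  label : List ℕ
  /-- a pair generating the smallest congruence not below the `j`-th congruence -/
  edge : Fin m → Fin (n + 1) × Fin (n + 1)
  /-- the other covers separated by the `j`-th congruence: each of them generates a later member
  of the list or `edge j` -/
  above : Fin m → List (Fin (n + 1) × Fin (n + 1))
  /-- further covers that generate the same congruence as `edge j`: each of them is generated by
  a later member of the list or by `edge j` -/
  below : Fin m → List (Fin (n + 1) × Fin (n + 1))

namespace LatTable

variable {n m : ℕ} (T : LatTable n m)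

/-- The digit with index `j` of the row with index `i`. -/
def entry (rows : List ℕ) (i j : ℕ) : ℕ := rows.getD i 0 / 100 ^ j % 100

/-- The join operation. -/
def sup (a b : Fin (n + 1)) : Fin (n + 1) := Fin.ofNat (n + 1) (entry T.join a b)

/-- The meet operation. -/
def inf (a b : Fin (n + 1)) : Fin (n + 1) := Fin.ofNat (n + 1) (entry T.meet a b)

/-- The class of `a` in the `j`-th congruence. -/
def lab (j : Fin m) (a : Fin (n + 1)) : ℕ := entry T.label j a

/-- The set of congruences separating two elements. -/
def color (a b : Fin (n + 1)) : Finset (Fin m) :=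
  Finset.univ.filter fun j => T.lab j a ≠ T.lab j b

/-- The pair `e` is mapped to the pair `f` by joining and meeting with constants. -/
def step (e f : Fin (n + 1) × Fin (n + 1)) : Bool :=
  (T.inf (T.sup e.1 f.1) f.2 == f.1 && T.inf (T.sup e.2 f.1) f.2 == f.2) ||
    (T.sup (T.inf e.1 f.2) f.1 == f.1 && T.sup (T.inf e.2 f.2) f.1 == f.2)

/-- Every member of the list is related by `s` to a later member or to `e`. -/
def isDerivation {α : Type*} (s : α → α → Bool) (e : α) : List α → Bool
  | [] => true
  | x :: l => (s x e || l.any (s x)) && isDerivation s e l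

/-- The order between the join-irreducible congruences; row `j` is the binary encoding of the set
of indices below `j`. -/
def rel (rows : List ℕ) (i j : Fin m) : Prop := (rows.getD j 0).testBit i = true

instance (rows : List ℕ) (i j : Fin m) : Decidable (rel rows i j) :=
  inferInstanceAs (Decidable (_ = true))

/-- The table describes a lattice whose congruence lattice is that of the order `rel rows`, in
which the sets in `Out` are exactly the non-principal congruences, and those in `In` are principal
though not required to be. -/
structure Valid (rows : List ℕ) (In Out : List (Finset (Fin m))) : Prop where
  sup_comm : ∀ a b, T.sup a b = T.sup b a
  sup_assoc : ∀ a b c, T.sup (T.sup a b) c = T.sup a (T.sup b c)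
  inf_comm : ∀ a b, T.inf a b = T.inf b a
  inf_assoc : ∀ a b c, T.inf (T.inf a b) c = T.inf a (T.inf b c)
  sup_inf_self : ∀ a b, T.sup a (T.inf a b) = a
  inf_sup_self : ∀ a b, T.inf a (T.sup a b) = a
  lab_sup : ∀ j a b, T.lab j a = T.lab j b → ∀ c, T.lab j (T.sup a c) = T.lab j (T.sup b c)
  lab_inf : ∀ j a b, T.lab j a = T.lab j b → ∀ c, T.lab j (T.inf a c) = T.lab j (T.inf b c)
  edge_rel : ∀ i j, T.lab i (T.edge j).1 ≠ T.lab i (T.edge j).2 ↔ rel rows i j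
  above_step : ∀ j, isDerivation T.step (T.edge j) (T.above j) = true
  below_step : ∀ j, isDerivation (fun e f => T.step f e) (T.edge j) (T.below j) = true
  cover : ∀ a b, a ≠ b → T.sup a b = b →
    (∃ z, z ≠ a ∧ z ≠ b ∧ T.sup a z = z ∧ T.sup z b = b) ∨
      (∀ j, T.lab j a ≠ T.lab j b → (a, b) = T.edge j ∨ (a, b) ∈ T.above j) ∧
        ∃ j, T.lab j a ≠ T.lab j b ∧ ((a, b) = T.edge j ∨ (a, b) ∈ T.below j)
  color_lower : ∀ i j, rel rows i j → ∀ a b, T.lab j a ≠ T.lab j b → T.lab i a ≠ T.lab i b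
  color_not_mem : ∀ a b, T.color a b ∉ Out
  exists_color : ∀ S : Finset (Fin m), (∀ i j, rel rows i j → j ∈ S → i ∈ S) → S ∉ Out →
    ∃ a b, T.color a b = S
  mem_of_lower : ∀ S : Finset (Fin m), (∀ i j, rel rows i j → j ∈ S → i ∈ S) → S ∉ Out →
    S ∈ In ∨ S = ∅ ∨ S = Finset.univ ∨ ∃ j, S = Finset.univ.filter fun i => rel rows i j

end LatTable

namespace LatTable

variable {n m : ℕ} {T : LatTable n m} {rows : List ℕ} {In Out : List (Finset (Fin m))}

theorem isDerivation_imp {α : Type*} {s : α → α → Bool} {P : α → Prop}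
    (hs : ∀ x y, s x y = true → P x → P y) {e : α} :
    ∀ {l : List α}, isDerivation s e l = true → ∀ x ∈ l, P x → P e
  | [], _, _, hx, _ => absurd hx List.not_mem_nil
  | y :: l, h, x, hx, hPx => by
    rw [isDerivation, Bool.and_eq_true, Bool.or_eq_true, List.any_eq_true] at h
    rcases List.mem_cons.1 hx with rfl | hx
    · rcases h.1 with h₁ | ⟨z, hz, h₁⟩
      · exact hs _ _ h₁ hPx
      · exact isDerivation_imp hs h.2 z hz (hs _ _ h₁ hPx)
    · exact isDerivation_imp hs h.2 x hx hPx

theorem imp_of_isDerivation {α : Type*} {s : α → α → Bool} {P : α → Prop}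
    (hs : ∀ x y, s x y = true → P x → P y) {e : α} {l : List α}
    (h : isDerivation (fun e f => s f e) e l = true) (x : α) (hx : x ∈ l) (he : P e) : P x := by
  by_contra hPx
  exact isDerivation_imp (P := fun y => ¬ P y)
    (fun y z hyz hy hz => hy (hs z y hyz hz)) h x hx hPx he

/-- The lattice described by a table. -/
abbrev Valid.lattice (hT : T.Valid rows In Out) : Lattice (Fin (n + 1)) :=
  letI : Max (Fin (n + 1)) := ⟨T.sup⟩
  letI : Min (Fin (n + 1)) := ⟨T.inf⟩
  Lattice.mk' hT.sup_comm hT.sup_assoc hT.inf_comm hT.inf_assoc hT.sup_inf_self hT.inf_sup_self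

/-- The carrier of the lattice described by a table. -/
def Carrier (_ : LatTable n m) : Type := Fin (n + 1)

instance : Fintype T.Carrier := inferInstanceAs (Fintype (Fin (n + 1)))

theorem step_sound [Lattice T.Carrier] (hs : ∀ a b : T.Carrier, a ⊔ b = T.sup a b)
    (hi : ∀ a b : T.Carrier, a ⊓ b = T.inf a b) (θ : LatCon T.Carrier)
    (e f : T.Carrier × T.Carrier) (h : T.step e f = true) (he : θ.r e.1 e.2) : θ.r f.1 f.2 := by
  simp only [step, Bool.or_eq_true, Bool.and_eq_true, beq_iff_eq] at h
  have hsi : ∀ a b c d : T.Carrier, T.inf (T.sup a b) c = d → (a ⊔ b) ⊓ c = d := fun a b c d h =>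
    (hi _ _).trans ((congrArg (T.inf · c) (hs a b)).trans h)
  have his : ∀ a b c d : T.Carrier, T.sup (T.inf a b) c = d → a ⊓ b ⊔ c = d := fun a b c d h =>
    (hs _ _).trans ((congrArg (T.sup · c) (hi a b)).trans h)
  rcases h with ⟨h₁, h₂⟩ | ⟨h₁, h₂⟩
  · have := θ.inf_comp (θ.sup_comp he (θ.refl f.1)) (θ.refl f.2)
    rwa [hsi _ _ _ _ h₁, hsi _ _ _ _ h₂] at this
  · have := θ.sup_comp (θ.inf_comp he (θ.refl f.2)) (θ.refl f.1)
    rwa [his _ _ _ _ h₁, his _ _ _ _ h₂] at this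

theorem Valid.representable_range (hT : T.Valid rows In Out) {D : Type*} [DistribLattice D]
    [BoundedOrder D] [Finite D] (p : Fin m → D) (hp : ∀ x, SupIrred x ↔ ∃ j, p j = x)
    (hrel : ∀ i j, p i ≤ p j ↔ rel rows i j) :
    Representable D {x | ∃ a b, (T.color a b).sup p = x} := by
  let _ : Lattice T.Carrier := hT.lattice
  let lab : Fin m → T.Carrier → ℕ := T.lab
  have hs : ∀ a b : T.Carrier, a ⊔ b = T.sup a b := fun _ _ => rfl
  have hi : ∀ a b : T.Carrier, a ⊓ b = T.inf a b := fun _ _ => rfl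
  have hlsup : ∀ j (a b c : T.Carrier), lab j a = lab j b → lab j (a ⊔ c) = lab j (b ⊔ c) :=
    fun j a b c h => hT.lab_sup j a b h c
  have hlinf : ∀ j (a b c : T.Carrier), lab j a = lab j b → lab j (a ⊓ c) = lab j (b ⊓ c) :=
    fun j a b c h => hT.lab_inf j a b h c
  let ker (j : Fin m) : LatCon T.Carrier := LatCon.ofUnary (fun a b => lab j a = lab j b)
    (fun _ => rfl) (fun _ _ => Eq.symm) (fun _ _ _ => Eq.trans) (hlsup j) (hlinf j)
  have habove : ∀ (θ : LatCon T.Carrier) j (e : Fin (n + 1) × Fin (n + 1)),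
      e = T.edge j ∨ e ∈ T.above j → θ.r e.1 e.2 → θ.r (T.edge j).1 (T.edge j).2 := by
    rintro θ j e (rfl | he) h
    · exact h
    · exact isDerivation_imp (P := fun e => θ.r e.1 e.2) (step_sound hs hi θ) (hT.above_step j)
        e he h
  have hbelow : ∀ (θ : LatCon T.Carrier) j (e : Fin (n + 1) × Fin (n + 1)),
      e = T.edge j ∨ e ∈ T.below j → θ.r (T.edge j).1 (T.edge j).2 → θ.r e.1 e.2 := by
    rintro θ j e (rfl | he) h
    · exact h
    · exact imp_of_isDerivation (P := fun e => θ.r e.1 e.2) (step_sound hs hi θ) (hT.below_step j)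
        e he h
  have hcover : ∀ a b : T.Carrier, a ≠ b → a ≤ b →
      (∃ z, z ≠ a ∧ z ≠ b ∧ a ≤ z ∧ z ≤ b) ∨
        (∀ j, lab j a ≠ lab j b → (a, b) = T.edge j ∨ (a, b) ∈ T.above j) ∧
          ∃ j, lab j a ≠ lab j b ∧ ((a, b) = T.edge j ∨ (a, b) ∈ T.below j) := by
    intro a b hne hab
    refine (hT.cover a b hne (sup_eq_right.2 hab)).imp_left ?_
    rintro ⟨z, hza, hzb, haz, hzb'⟩
    exact ⟨z, hza, hzb, sup_eq_right.1 haz, sup_eq_right.1 hzb'⟩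
  have key : ∀ (θ : LatCon T.Carrier) (N : ℕ) (a b : T.Carrier), a ≤ b →
      (Set.Icc a b).ncard ≤ N →
      (∀ j, θ.r a b → lab j a ≠ lab j b → θ.r (T.edge j).1 (T.edge j).2) ∧
      ((∀ j, lab j a ≠ lab j b → θ.r (T.edge j).1 (T.edge j).2) → θ.r a b) := by
    intro θ N
    induction N with
    | zero =>
      intro a b hab hN
      rw [Nat.le_zero, Set.ncard_eq_zero] at hN
      exact absurd hN (Set.nonempty_Icc.2 hab).ne_empty
    | succ N ih =>
      intro a b hab hN
      rcases eq_or_ne a b with rfl | hne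
      · exact ⟨fun j _ h => absurd rfl h, fun _ => θ.refl a⟩
      rcases hcover a b hne hab with ⟨z, hza, hzb, haz, hzb'⟩ | ⟨h₁, j, hj, h₂⟩
      · have hlt₁ : (Set.Icc a z).ncard < (Set.Icc a b).ncard :=
          Set.ncard_lt_ncard ⟨Set.Icc_subset_Icc_right hzb', fun h =>
            hzb (le_antisymm hzb' (h (Set.right_mem_Icc.2 hab)).2)⟩
        have hlt₂ : (Set.Icc z b).ncard < (Set.Icc a b).ncard :=
          Set.ncard_lt_ncard ⟨Set.Icc_subset_Icc_left haz, fun h =>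
            hza (le_antisymm (h (Set.left_mem_Icc.2 hab)).1 haz)⟩
        have ih₁ := ih a z haz (by omega)
        have ih₂ := ih z b hzb' (by omega)
        constructor
        · intro j h hj
          by_cases hjz : lab j a = lab j z
          · exact ih₂.1 j (LatCon.rel_of_le h haz hzb' le_rfl) (hjz ▸ hj)
          · exact ih₁.1 j (LatCon.rel_of_le h le_rfl haz hzb') hjz
        · intro h
          refine θ.trans (ih₁.2 fun j hj => h j fun hab' => hj ?_)
            (ih₂.2 fun j hj => h j fun hab' => hj ?_)
          · exact LatCon.rel_of_le (θ := ker j) hab' le_rfl haz hzb'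
          · exact LatCon.rel_of_le (θ := ker j) hab' haz hzb' le_rfl
      · exact ⟨fun j h hj => habove θ j (a, b) (h₁ j hj) h,
          fun h => hbelow θ j (a, b) h₂ (h j hj)⟩
  have hker : ∀ j (a b : T.Carrier), lab j a = lab j b ↔ lab j (a ⊓ b) = lab j (a ⊔ b) :=
    fun j a b => ⟨LatCon.rel_inf_sup (θ := ker j), LatCon.rel_of_rel_inf_sup (θ := ker j)⟩
  refine representable_of_labels (L := T.Carrier) p hp lab T.edge hlsup hlinf
    (fun i j => (hT.edge_rel i j).trans (hrel i j).symm) ?_ ?_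
  · intro θ j a b h hj
    rw [Ne, hker] at hj
    exact (key θ _ _ _ inf_le_sup le_rfl).1 j (LatCon.rel_inf_sup h) hj
  · intro θ a b h
    refine LatCon.rel_of_rel_inf_sup ((key θ _ _ _ inf_le_sup le_rfl).2 fun j hj => h j ?_)
    rwa [Ne, hker]

theorem Valid.representable (hT : T.Valid rows In Out) {D : Type*} [DistribLattice D]
    [BoundedOrder D] [Finite D] (p : Fin m → D) (hp : ∀ x, SupIrred x ↔ ∃ j, p j = x)
    (hrel : ∀ i j, p i ≤ p j ↔ rel rows i j) {Q : Set D} (hQ : Jplus D ⊆ Q)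
    (hOut : ∀ S ∈ Out, S.sup p ∉ Q) (hIn : ∀ S ∈ In, S.sup p ∈ Q) : Representable D Q := by
  classical
  have hdec : ∀ x, (Finset.univ.filter fun i => p i ≤ x).sup p = x := by
    intro x
    refine le_antisymm (Finset.sup_le fun i hi => (Finset.mem_filter.1 hi).2) ?_
    obtain ⟨s, hs, hs'⟩ := exists_supIrred_decomposition x
    rw [← hs]
    refine Finset.sup_le fun y hy => ?_
    obtain ⟨j, rfl⟩ := (hp y).1 (hs' hy)
    refine Finset.le_sup (f := p) (Finset.mem_filter.2 ⟨Finset.mem_univ _, ?_⟩)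
    exact Finset.le_sup (f := id) hy
  have hlow : ∀ x i j, rel rows i j → j ∈ (Finset.univ.filter fun i => p i ≤ x) →
      i ∈ (Finset.univ.filter fun i => p i ≤ x) := by
    intro x i j hij hj
    simp only [Finset.mem_filter, Finset.mem_univ, true_and] at hj ⊢
    exact ((hrel i j).2 hij).trans hj
  convert hT.representable_range p hp hrel
  ext x
  constructor
  · intro hx
    obtain ⟨a, b, hab⟩ := hT.exists_color _ (hlow x) fun h => hOut _ h (by rwa [hdec])
    exact ⟨a, b, by rw [hab, hdec]⟩
  · rintro ⟨a, b, rfl⟩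
    rcases hT.mem_of_lower (T.color a b) (fun i j hij hj => by
      simp only [color, Finset.mem_filter, Finset.mem_univ, true_and] at hj ⊢
      exact hT.color_lower i j hij a b hj) (hT.color_not_mem a b) with h | h | h | ⟨j, h⟩
    · exact hIn _ h
    · rw [h]
      exact hQ (Or.inl (Or.inl rfl))
    · rw [h]
      refine hQ (Or.inl (Or.inr (top_unique ?_)))
      rw [← hdec ⊤]
      exact Finset.sup_mono (Finset.subset_univ _)
    · rw [h]
      refine hQ (Or.inr ?_)
      have : (Finset.univ.filter fun i => rel rows i j) =
          Finset.univ.filter fun i => p i ≤ p j := by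
        ext i
        simp [hrel]
      rw [this, hdec]
      exact (hp _).2 ⟨j, rfl⟩

end LatTable

namespace LatTable

-- The tables are named after the ordered set of join-irreducible congruences: an antichain or an
-- element together with a chain of two elements (`pair`), with further elements added at the bottom
-- or at the top. In the tables called `Compl`, an additional congruence is not principal.

def antichainTable : LatTable 2 2 where
  join := [20100, 20101, 20202]
  meet := [0, 10100, 20100]
  label := [10100, 10000]
  edge := ![(0, 1), (1, 2)]
  above := ![
    [],
    []]
  below := ![
    [],
    []]

theorem antichainTable_valid :
    antichainTable.Valid [1, 2] [] [] := by
  constructor <;> decide +kernel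

def antichainBotTable : LatTable 4 3 where
  join := [403020100, 404020101, 404020202, 403040403, 404040404]
  meet := [0, 100010100, 200020100, 303000000, 403020100]
  label := [403020100, 100010100, 101000000]
  edge := ![(1, 2), (0, 1), (0, 3)]
  above := ![
    [(2, 4), (0, 1), (3, 4), (0, 3)],
    [(3, 4)],
    [(2, 4)]]
  below := ![
    [],
    [(3, 4)],
    [(2, 4)]]

theorem antichainBotTable_valid :
    antichainBotTable.Valid [1, 3, 5] [] [] := by
  constructor <;> decide +kernel

def antichainBotBotTable : LatTable 7 4 where
  join := [706050403020100, 707050403050101, 706050707020502, 707070403070303, 707070404070404,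
    707050707050505, 706070707060706, 707070707070707]
  meet := [0, 100010101000100, 202020000020000, 300010303000100, 400010403000100, 502050101020100,
    606020000020000, 706050403020100]
  label := [706050403020100, 605040303020100, 100010101000100, 101010000010000]
  edge := ![(3, 4), (1, 3), (0, 1), (0, 2)]
  above := ![
    [(4, 7), (2, 6), (2, 5), (1, 3), (0, 1), (6, 7), (5, 7), (1, 5), (0, 2)],
    [(1, 5), (0, 2), (4, 7), (2, 5), (0, 1), (6, 7), (5, 7), (2, 6)],
    [(6, 7), (2, 5)],
    [(4, 7), (1, 5)]]
  below := ![
    [],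
    [(5, 7), (2, 6)],
    [(6, 7), (2, 5)],
    [(4, 7), (1, 5)]]

theorem antichainBotBotTable_valid :
    antichainBotBotTable.Valid [1, 3, 7, 11] [] [] := by
  constructor <;> decide +kernel

def antichainBotBotBotTable : LatTable 9 5 where
  join := [9080706050403020100, 9090706050403040101, 9080906050406020402, 9090706060603060303,
    9090906050406040404, 9090906050506050505, 9090906060606060606, 9090709090907090707,
    9080909090909080908, 9090909090909090909]
  meet := [0, 1000101010101000100, 2020002020200020000, 3000303010103000100, 4020104040401020100,
    5020105050401020100, 6020306050403020100, 7000703010103000100, 8080002020200020000,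
    9080706050403020100]
  label := [9080706050403020100, 8070605040403020100, 6050403030301020100, 1000101010101000100,
    1010001010100010000]
  edge := ![(4, 5), (1, 3), (2, 8), (0, 1), (0, 2)]
  above := ![
    [(6, 9), (5, 6), (3, 7), (2, 4), (1, 4), (0, 2), (0, 1), (8, 9), (7, 9), (3, 6), (2, 8),
     (1, 3)],
    [(3, 6), (1, 4), (0, 2), (7, 9), (6, 9), (3, 7), (2, 4), (0, 1), (8, 9), (5, 6), (2, 8)],
    [(2, 4), (0, 1), (8, 9), (3, 6), (1, 4), (0, 2), (7, 9), (6, 9), (3, 7)],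
    [(8, 9), (2, 4)],
    [(7, 9), (3, 6), (1, 4)]]
  below := ![
    [],
    [(5, 6)],
    [(6, 9), (3, 7)],
    [(8, 9), (2, 4)],
    [(7, 9), (3, 6), (1, 4)]]

theorem antichainBotBotBotTable_valid :
    antichainBotBotBotTable.Valid [1, 3, 7, 15, 23] [] [] := by
  constructor <;> decide +kernel

def antichainTopTable : LatTable 6 3 where
  join := [6050403020100, 6060603060101, 6060406020602, 6060603060303, 6060406040604, 6050606060605,
    6060606060606]
  meet := [0, 1000001000100, 2000200020000, 3000003000100, 4000400020000, 5050000000000,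
    6050403020100]
  label := [5040203020100, 5040301020100, 4030201020100]
  edge := ![(1, 3), (2, 4), (0, 1)]
  above := ![
    [(3, 6), (0, 1), (5, 6), (4, 6), (0, 5), (0, 2)],
    [(4, 6), (0, 2), (5, 6), (3, 6), (0, 5), (0, 1)],
    [(3, 6), (0, 5), (0, 2), (5, 6), (4, 6)]]
  below := ![
    [],
    [],
    [(3, 6), (0, 5), (0, 2), (5, 6), (4, 6)]]

theorem antichainTopTable_valid :
    antichainTopTable.Valid [1, 2, 7] [] [{0, 1}] := by
  constructor <;> decide +kernel

def antichainBotTopTable : LatTable 12 4 where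
  join := [12111009080706050403020100, 12111009111006050403020101, 12111009111009050505020202,
    12121209121206050403050303, 12121209121209050404050404, 12121209121209050505050505,
    12121209121206090906090606, 12121012120712121212101007, 12111212081212121212111108,
    12121209121209090909090909, 12121012121012121212101010, 12111212111212121212111111,
    12121212121212121212121212]
  meet := [0, 1010101000001010101010100, 2020202000001020101020100, 3010103000003030303010100,
    4010104000003040403010100, 5020205000003050403020100, 6010106000006030303010100,
    7000700000700000000000000, 8080000080000000000000000, 9020209000006050403020100,
    10021002000701020101020100, 11110202080001020101020100, 12111009080706050403020100]
  label := [12111009080706050403020100, 7060502040302020202010100, 5040302040302010101000000,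
    4030201030201010101000000]
  edge := ![(1, 2), (0, 1), (3, 6), (0, 7)]
  above := ![
    [(5, 9), (2, 5), (1, 3), (11, 12), (10, 12), (9, 12), (3, 6), (3, 4), (2, 11), (2, 10),
     (0, 1), (8, 11), (7, 10), (6, 9), (4, 5), (0, 8), (0, 7)],
    [(2, 5), (1, 3), (11, 12), (10, 12), (9, 12), (2, 11), (2, 10), (0, 8), (0, 7), (8, 11),
     (7, 10)],
    [(9, 12), (2, 5), (1, 3), (11, 12), (10, 12), (5, 9), (2, 11), (2, 10), (0, 8), (0, 7)],
    [(10, 12), (2, 11), (2, 5), (1, 3), (0, 8), (11, 12), (9, 12), (2, 10)]]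
  below := ![
    [(6, 9), (4, 5), (3, 4)],
    [(8, 11), (7, 10)],
    [(5, 9)],
    [(10, 12), (2, 11), (2, 5), (1, 3), (0, 8), (11, 12), (9, 12), (2, 10)]]

theorem antichainBotTopTable_valid :
    antichainBotTopTable.Valid [1, 3, 5, 15] [] [{0, 1, 2}] := by
  constructor <;> decide +kernel

def antichainBotBotTopTable : LatTable 13 5 where
  join := [1312111009080706050403020100, 1312111009121106050403020101, 1312111009121110050505020202,
    1313131009131306050403050303, 1313131009131310050404050404, 1313131009131310050505050505,
    1313131010131306101006100606, 1313111313130713131313111107, 1312131313081313131313121208,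
    1313131009131310090909090909, 1313131010131310101010101010, 1313111313131113131313111111,
    1312131313121313131313121212, 1313131313131313131313131313]
  meet := [0, 101010101000001010101010100, 202020202000001020101020100, 301010303000003030303010100,
    401010404000003040403010100, 502020505000003050403020100, 601010603000006030303010100,
    700070000000700000000000000, 808000000080000000000000000, 902020909000003050403020100,
    1002021009000006050403020100, 1102110202000701020101020100, 1212020202080001020101020100,
    1312111009080706050403020100]
  label := [1312111009080706050403020100, 1211100905080706050403020100, 706050202040302020202010100,
    504030201040302010101000000, 403020101030201010101000000]
  edge := ![(5, 9), (1, 2), (0, 1), (3, 6), (0, 7)]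
  above := ![
    [(4, 5), (0, 1), (10, 13), (9, 10), (8, 12), (7, 11), (3, 4), (2, 5), (1, 3), (1, 2),
     (12, 13), (11, 13), (6, 10), (3, 6), (2, 12), (2, 11), (0, 8), (0, 7)],
    [(9, 10), (2, 5), (1, 3), (12, 13), (11, 13), (10, 13), (3, 6), (3, 4), (2, 12), (2, 11),
     (0, 1), (8, 12), (7, 11), (6, 10), (4, 5), (0, 8), (0, 7)],
    [(2, 5), (1, 3), (12, 13), (11, 13), (10, 13), (2, 12), (2, 11), (0, 8), (0, 7), (8, 12),
     (7, 11)],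
    [(10, 13), (2, 5), (1, 3), (12, 13), (11, 13), (9, 10), (2, 12), (2, 11), (0, 8), (0, 7)],
    [(11, 13), (2, 12), (2, 5), (1, 3), (0, 8), (12, 13), (10, 13), (2, 11)]]
  below := ![
    [],
    [(6, 10), (4, 5), (3, 4)],
    [(8, 12), (7, 11)],
    [(9, 10)],
    [(11, 13), (2, 12), (2, 5), (1, 3), (0, 8), (12, 13), (10, 13), (2, 11)]]

theorem antichainBotBotTopTable_valid :
    antichainBotBotTopTable.Valid [1, 3, 7, 11, 31] [] [{0, 1, 2, 3}] := by
  constructor <;> decide +kernel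

def twoAntichainsTable : LatTable 5 4 where
  join := [50403020100, 50503020101, 50503020202, 50503030303, 50405050504, 50505050505]
  meet := [0, 10001010100, 20002020100, 30003020100, 40400000000, 50403020100]
  label := [40302020100, 40302010100, 10001010100, 10100000000]
  edge := ![(1, 2), (2, 3), (0, 1), (0, 4)]
  above := ![
    [(3, 5), (0, 1), (4, 5), (0, 4)],
    [(3, 5), (0, 1), (4, 5), (0, 4)],
    [(4, 5)],
    [(3, 5)]]
  below := ![
    [],
    [],
    [(4, 5)],
    [(3, 5)]]

theorem twoAntichainsTable_valid :
    twoAntichainsTable.Valid [1, 2, 7, 11] [{0, 1}] [] := by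
  constructor <;> decide +kernel

def twoAntichainsComplTable : LatTable 5 4 where
  join := [50403020100, 50503050101, 50405020502, 50503050303, 50405040504, 50505050505]
  meet := [0, 10001000100, 20200020000, 30003000100, 40400020000, 50403020100]
  label := [40203020100, 40301020100, 10001000100, 10100010000]
  edge := ![(1, 3), (2, 4), (0, 1), (0, 2)]
  above := ![
    [(3, 5), (0, 1), (4, 5), (0, 2)],
    [(4, 5), (0, 2), (3, 5), (0, 1)],
    [(4, 5)],
    [(3, 5)]]
  below := ![
    [],
    [],
    [(4, 5)],
    [(3, 5)]]

theorem twoAntichainsComplTable_valid :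
    twoAntichainsComplTable.Valid [1, 2, 7, 11] [] [{0, 1}] := by
  constructor <;> decide +kernel

def pairTable : LatTable 6 3 where
  join := [6050403020100, 6050403020101, 6060403020202, 6060603030303, 6060406040404, 6050606060505,
    6060606060606]
  meet := [0, 1010101010100, 2010202020100, 3010203020100, 4010402020100, 5050101010100,
    6050403020100]
  label := [5040302010000, 1000101010000, 1010101010100]
  edge := ![(1, 5), (1, 2), (0, 1)]
  above := ![
    [(1, 2), (5, 6), (2, 4), (2, 3), (4, 6), (3, 6)],
    [(5, 6)],
    []]
  below := ![
    [(4, 6), (3, 6), (2, 4), (2, 3)],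
    [(5, 6)],
    []]

theorem pairTable_valid :
    pairTable.Valid [1, 3, 4] [{0, 2}] [] := by
  constructor <;> decide +kernel

def pairComplTable : LatTable 6 3 where
  join := [6050403020100, 6050403020101, 6060603020202, 6060603030303, 6060406060404, 6050606060505,
    6060606060606]
  meet := [0, 1010101010100, 2010102020100, 3010103020100, 4010401010100, 5050101010100,
    6050403020100]
  label := [5040302010000, 4030201010000, 1010101010100]
  edge := ![(2, 3), (1, 2), (0, 1)]
  above := ![
    [(3, 6), (1, 2), (5, 6), (4, 6), (1, 5), (1, 4)],
    [(3, 6), (1, 5), (1, 4), (5, 6), (4, 6)],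
    []]
  below := ![
    [],
    [(3, 6), (1, 5), (1, 4), (5, 6), (4, 6)],
    []]

theorem pairComplTable_valid :
    pairComplTable.Valid [1, 3, 4] [] [{0, 2}] := by
  constructor <;> decide +kernel

def pairBotTable : LatTable 8 4 where
  join := [80706050403020100, 80706050505020101, 80706080808020202, 80808050403080503,
    80808050404080504, 80808050505080505, 80806080808060606, 80708080808070707, 80808080808080808]
  meet := [0, 10101010000010100, 20202010000020100, 30000030303000000, 40000040403000000,
    50101050403010100, 60206010000020100, 70702010000020100, 80706050403020100]
  label := [80706050403020100, 50403020202010000, 10101000000010000, 10101010000010100]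
  edge := ![(3, 4), (0, 3), (1, 2), (0, 1)]
  above := ![
    [(1, 2), (5, 8), (4, 5), (2, 7), (2, 6), (0, 3), (7, 8), (6, 8), (1, 5), (0, 1)],
    [(1, 2), (5, 8), (2, 7), (2, 6), (7, 8), (6, 8), (1, 5)],
    [(5, 8)],
    [(4, 5)]]
  below := ![
    [],
    [(7, 8), (6, 8), (2, 7), (2, 6), (1, 5)],
    [(5, 8)],
    [(4, 5)]]

theorem pairBotTable_valid :
    pairBotTable.Valid [1, 3, 7, 9] [{0, 1, 3}] [] := by
  constructor <;> decide +kernel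

def pairBotComplTable : LatTable 11 4 where
  join := [111009080706050403020100, 111009080906050403020101, 111009080908050505020202,
    111111081106050403050303, 111111081108050404050404, 111111081108050505050505,
    111111081106080806080606, 111109110711111111090907, 111111081108080808080808,
    111109110911111111090909, 111011111111111111101010, 111111111111111111111111]
  meet := [0, 10101010001010101010100, 20202020001020101020100, 30101030003030303010100,
    40101040003040403010100, 50202050003050403020100, 60101060006030303010100,
    70007000700000000000000, 80202080006050403020100, 90209020701020101020100,
    101002020001020101020100, 111009080706050403020100]
  label := [111009080706050403020100, 50403020302010101000000, 40302010201010101000000,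
    10101010001010101010100]
  edge := ![(1, 2), (3, 6), (0, 7), (0, 1)]
  above := ![
    [(9, 11), (5, 8), (2, 10), (2, 5), (1, 3), (10, 11), (8, 11), (3, 6), (3, 4), (2, 9),
     (0, 1), (7, 9), (6, 8), (4, 5), (0, 7)],
    [(8, 11), (2, 5), (1, 3), (10, 11), (9, 11), (5, 8), (2, 10), (2, 9), (0, 7)],
    [(9, 11), (2, 10), (2, 5), (1, 3), (10, 11), (8, 11), (2, 9)],
    [(7, 9)]]
  below := ![
    [(6, 8), (4, 5), (3, 4)],
    [(5, 8)],
    [(9, 11), (2, 10), (2, 5), (1, 3), (10, 11), (8, 11), (2, 9)],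
    [(7, 9)]]

theorem pairBotComplTable_valid :
    pairBotComplTable.Valid [1, 3, 7, 9] [] [{0, 1, 3}] := by
  constructor <;> decide +kernel

def pairTopTable : LatTable 10 4 where
  join := [1009080706050403020100, 1010100706050405050101, 1010080707050505020502,
    1009100707050503050503, 1010100706050405050404, 1010100707050505050505, 1010100706070607070606,
    1010100707070707070707, 1010081010101010081008, 1009101010101009101009, 1010101010101010101010]
  meet := [0, 100000101010100000100, 200020200020000020000, 303000300030003000000,
    400000404040400000100, 503020504050403020100, 600000606040400000100, 703020706050403020100,
    800080200020000020000, 909000300030003000000, 1009080706050403020100]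
  label := [908070605040103020100, 706050401040103020100, 503020504050403020100,
    403020401040103020100]
  edge := ![(4, 6), (2, 8), (1, 4), (0, 1)]
  above := ![
    [(6, 7), (4, 5), (7, 10), (3, 5), (2, 5), (0, 3), (0, 2), (0, 1), (9, 10), (8, 10),
     (5, 7), (3, 9), (2, 8)],
    [(6, 7), (4, 5), (2, 5), (0, 3), (8, 10), (3, 5), (0, 2), (0, 1), (9, 10), (7, 10), (3, 9)],
    [(6, 7), (4, 5), (0, 1), (9, 10), (8, 10), (3, 5), (2, 5), (0, 3), (0, 2)],
    [(6, 7), (4, 5), (0, 3), (0, 2), (9, 10), (8, 10), (3, 5), (2, 5)]]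
  below := ![
    [(5, 7)],
    [(7, 10), (3, 9)],
    [],
    [(6, 7), (4, 5), (0, 3), (0, 2), (9, 10), (8, 10), (3, 5), (2, 5)]]

theorem pairTopTable_valid :
    pairTopTable.Valid [1, 3, 4, 15] [{0, 2}] [{0, 1, 2}] := by
  constructor <;> decide +kernel

def pairTopComplTable : LatTable 9 4 where
  join := [9080706050403020100, 9080706080406060101, 9090906090903020602, 9090906090903030603,
    9090709090409090404, 9080909050909090805, 9090906090906060606, 9090709090709090707,
    9080909080909090808, 9090909090909090909]
  meet := [0, 1010101000100000100, 2000002000002020000, 3000003000003020000, 4010401000400000100,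
    5050000050000000000, 6010106000103020100, 7010701000400000100, 8080101050100000100,
    9080706050403020100]
  label := [8070406050403020100, 7060305040302020100, 5030401030201010000, 4030201030201010000]
  edge := ![(2, 3), (0, 1), (4, 7), (0, 2)]
  above := ![
    [(6, 9), (5, 8), (3, 6), (1, 8), (1, 4), (0, 2), (8, 9), (7, 9), (1, 6), (0, 5), (0, 1)],
    [(1, 4), (8, 9), (7, 9), (6, 9), (1, 8), (1, 6), (0, 5), (0, 2), (5, 8), (3, 6)],
    [(7, 9), (1, 4), (8, 9), (6, 9), (1, 8), (1, 6), (0, 5), (0, 2)],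
    [(6, 9), (1, 8), (1, 4), (0, 5), (8, 9), (7, 9), (1, 6)]]
  below := ![
    [],
    [(5, 8), (3, 6)],
    [],
    [(6, 9), (1, 8), (1, 4), (0, 5), (8, 9), (7, 9), (1, 6)]]

theorem pairTopComplTable_valid :
    pairTopComplTable.Valid [1, 3, 4, 15] [] [{0, 1, 2}, {0, 2}] := by
  constructor <;> decide +kernel

end LatTable

/-- The disjoint union of a lattice with three pairwise incomparable points, with bounds
adjoined. -/
inductive ThreePointSum (L : Type) : Type
  | bot : ThreePointSum L
  | top : ThreePointSum L
  | mid (x : L) : ThreePointSum L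
  | pt (i : Fin 3) : ThreePointSum L

namespace ThreePointSum

variable {L : Type}

noncomputable instance [Fintype L] : Fintype (ThreePointSum L) :=
  have := Finite.of_surjective
    (Sum.elim (Sum.elim mid pt) fun b : Bool => if b then (bot : ThreePointSum L) else top) fun
    | bot => ⟨Sum.inr true, rfl⟩
    | top => ⟨Sum.inr false, rfl⟩
    | mid x => ⟨Sum.inl (Sum.inl x), rfl⟩
    | pt i => ⟨Sum.inl (Sum.inr i), rfl⟩
  Fintype.ofFinite _

variable [Lattice L]

instance : Max (ThreePointSum L) where
  max
    | bot, b => b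
    | a, bot => a
    | mid x, mid y => mid (x ⊔ y)
    | pt i, pt j => if i = j then pt i else top
    | _, _ => top

instance : Min (ThreePointSum L) where
  min
    | top, b => b
    | a, top => a
    | mid x, mid y => mid (x ⊓ y)
    | pt i, pt j => if i = j then pt i else bot
    | _, _ => bot

@[simp] theorem bot_max (a : ThreePointSum L) : max bot a = a := by cases a <;> rfl
@[simp] theorem max_bot (a : ThreePointSum L) : max a bot = a := by cases a <;> rfl
@[simp] theorem top_max (a : ThreePointSum L) : max top a = top := by cases a <;> rfl
@[simp] theorem max_top (a : ThreePointSum L) : max a top = top := by cases a <;> rfl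
@[simp] theorem mid_max_mid (x y : L) : max (mid x) (mid y) = mid (x ⊔ y) := rfl
@[simp] theorem mid_max_pt (x : L) (i : Fin 3) : max (mid x) (pt i) = top := rfl
@[simp] theorem pt_max_mid (x : L) (i : Fin 3) : max (pt i) (mid x) = top := rfl
@[simp] theorem pt_max_pt (i j : Fin 3) :
    max (pt i) (pt j) = if i = j then pt i else (top : ThreePointSum L) := rfl

@[simp] theorem bot_min (a : ThreePointSum L) : min bot a = bot := by cases a <;> rfl
@[simp] theorem min_bot (a : ThreePointSum L) : min a bot = bot := by cases a <;> rfl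
@[simp] theorem top_min (a : ThreePointSum L) : min top a = a := by cases a <;> rfl
@[simp] theorem min_top (a : ThreePointSum L) : min a top = a := by cases a <;> rfl
@[simp] theorem mid_min_mid (x y : L) : min (mid x) (mid y) = mid (x ⊓ y) := rfl
@[simp] theorem mid_min_pt (x : L) (i : Fin 3) : min (mid x) (pt i) = bot := rfl
@[simp] theorem pt_min_mid (x : L) (i : Fin 3) : min (pt i) (mid x) = bot := rfl
@[simp] theorem pt_min_pt (i j : Fin 3) :
    min (pt i) (pt j) = if i = j then pt i else (bot : ThreePointSum L) := rfl

instance : Lattice (ThreePointSum L) :=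
  Lattice.mk'
    (by rintro (_ | _ | a | i) (_ | _ | b | j) <;> simp [sup_comm, eq_comm]; grind)
    (by
      rintro (_ | _ | a | i) (_ | _ | b | j) (_ | _ | c | k) <;> simp [sup_assoc] <;> split_ifs <;>
        simp_all)
    (by rintro (_ | _ | a | i) (_ | _ | b | j) <;> simp [inf_comm, eq_comm]; grind)
    (by
      rintro (_ | _ | a | i) (_ | _ | b | j) (_ | _ | c | k) <;> simp [inf_assoc] <;> split_ifs <;>
        simp_all)
    (by rintro (_ | _ | a | i) (_ | _ | b | j) <;> simp; split_ifs <;> simp_all)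
    (by rintro (_ | _ | a | i) (_ | _ | b | j) <;> simp; split_ifs <;> simp_all)

/-- The extension of a congruence by the equality relation. -/
def extend (θ : LatCon L) : LatCon (ThreePointSum L) :=
  LatCon.ofUnary (fun a b => a = b ∨ ∃ x y, θ.r x y ∧ a = mid x ∧ b = mid y)
    (fun a => Or.inl rfl)
    (by
      rintro a b (rfl | ⟨x, y, h, rfl, rfl⟩)
      · exact Or.inl rfl
      · exact Or.inr ⟨y, x, θ.symm h, rfl, rfl⟩)
    (by
      rintro a b c (rfl | ⟨x, y, h, rfl, rfl⟩) (rfl | ⟨x', y', h', h₁, rfl⟩)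
      · exact Or.inl rfl
      · exact Or.inr ⟨x', y', h', h₁, rfl⟩
      · exact Or.inr ⟨x, y, h, rfl, rfl⟩
      · cases h₁
        exact Or.inr ⟨x, y', θ.trans h h', rfl, rfl⟩)
    (by
      rintro a b c (rfl | ⟨x, y, h, rfl, rfl⟩)
      · exact Or.inl rfl
      · rcases c with _ | _ | z | i
        · exact Or.inr ⟨x, y, h, rfl, rfl⟩
        · exact Or.inl rfl
        · exact Or.inr ⟨_, _, θ.sup_comp h (θ.refl z), rfl, rfl⟩
        · exact Or.inl rfl)
    (by
      rintro a b c (rfl | ⟨x, y, h, rfl, rfl⟩)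
      · exact Or.inl rfl
      · rcases c with _ | _ | z | i
        · exact Or.inl rfl
        · exact Or.inr ⟨x, y, h, rfl, rfl⟩
        · exact Or.inr ⟨_, _, θ.inf_comp h (θ.refl z), rfl, rfl⟩
        · exact Or.inl rfl)

theorem extend_rel_mid {θ : LatCon L} {x y : L} : (extend θ).r (mid x) (mid y) ↔ θ.r x y := by
  constructor
  · rintro (h | ⟨x', y', h, hx, hy⟩)
    · cases h
      exact θ.refl x
    · cases hx
      cases hy
      exact h
  · exact fun h => Or.inr ⟨x, y, h, rfl, rfl⟩

/-- The restriction of a congruence to the original lattice. -/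
def restrict (θ : LatCon (ThreePointSum L)) : LatCon L where
  r x y := θ.r (mid x) (mid y)
  refl _ := θ.refl _
  symm h := θ.symm h
  trans h₁ h₂ := θ.trans h₁ h₂
  sup_comp h₁ h₂ := θ.sup_comp h₁ h₂
  inf_comp h₁ h₂ := θ.inf_comp h₁ h₂

theorem rel_bot_top_of_rel_bot {θ : LatCon (ThreePointSum L)} {a : ThreePointSum L}
    (h : θ.r bot a) (ha : a ≠ bot) : θ.r bot top := by
  obtain ⟨i, j, hij, hi, hj⟩ : ∃ i j : Fin 3, i ≠ j ∧ a ⊔ pt i = top ∧ a ⊔ pt j = top := by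
    rcases a with _ | _ | x | k
    · exact absurd rfl ha
    · exact ⟨0, 1, by decide, rfl, rfl⟩
    · exact ⟨0, 1, by decide, rfl, rfl⟩
    · obtain ⟨i, j, hij, hi, hj⟩ : ∃ i j : Fin 3, i ≠ j ∧ k ≠ i ∧ k ≠ j := by
        clear h ha
        revert k
        decide
      exact ⟨i, j, hij, if_neg hi, if_neg hj⟩
  have h₁ := θ.sup_comp h (θ.refl (pt i))
  have h₂ := θ.sup_comp h (θ.refl (pt j))
  rw [hi] at h₁
  rw [hj] at h₂
  have h₃ : θ.r (if i = j then pt i else bot) top := θ.inf_comp h₁ h₂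
  rwa [if_neg hij] at h₃

theorem rel_bot_top_of_rel_top {θ : LatCon (ThreePointSum L)} {a : ThreePointSum L}
    (h : θ.r a top) (ha : a ≠ top) : θ.r bot top := by
  obtain ⟨i, j, hij, hi, hj⟩ : ∃ i j : Fin 3, i ≠ j ∧ a ⊓ pt i = bot ∧ a ⊓ pt j = bot := by
    rcases a with _ | _ | x | k
    · exact ⟨0, 1, by decide, rfl, rfl⟩
    · exact absurd rfl ha
    · exact ⟨0, 1, by decide, rfl, rfl⟩
    · obtain ⟨i, j, hij, hi, hj⟩ : ∃ i j : Fin 3, i ≠ j ∧ k ≠ i ∧ k ≠ j := by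
        clear h ha
        revert k
        decide
      exact ⟨i, j, hij, if_neg hi, if_neg hj⟩
  have h₁ := θ.inf_comp h (θ.refl (pt i))
  have h₂ := θ.inf_comp h (θ.refl (pt j))
  rw [hi] at h₁
  rw [hj] at h₂
  have h₃ : θ.r bot (if i = j then pt i else top) := θ.sup_comp h₁ h₂
  rwa [if_neg hij] at h₃

theorem rel_bot_top {θ : LatCon (ThreePointSum L)} {a b : ThreePointSum L} (h : θ.r a b)
    (hab : a ≠ b) (hmid : ∀ x y, a = mid x → b ≠ mid y) : θ.r bot top := by
  have hi : a ⊓ b = bot ∨ a ⊔ b = top := by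
    rcases a with _ | _ | x | i
    · exact Or.inl (bot_min b)
    · exact Or.inr (top_max b)
    · rcases b with _ | _ | y | j
      · exact Or.inl rfl
      · exact Or.inr rfl
      · exact absurd rfl (hmid x y rfl)
      · exact Or.inl rfl
    · rcases b with _ | _ | y | j
      · exact Or.inl rfl
      · exact Or.inr rfl
      · exact Or.inl rfl
      · exact Or.inl (if_neg fun hij => hab (congrArg pt hij))
  have h' := LatCon.rel_inf_sup h
  have hne : a ⊓ b ≠ a ⊔ b := fun h => hab (inf_eq_sup.1 h)
  rcases hi with hi | hi
  · rw [hi] at h' hne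
    exact rel_bot_top_of_rel_bot h' hne.symm
  · rw [hi] at h' hne
    exact rel_bot_top_of_rel_top h' hne

theorem extend_restrict {θ : LatCon (ThreePointSum L)} (h : ¬ θ.r bot top) :
    extend (restrict θ) = θ := by
  refine LatCon.ext' fun a b => ⟨?_, fun hab => ?_⟩
  · rintro (rfl | ⟨x, y, hxy, rfl, rfl⟩)
    · exact θ.refl a
    · exact hxy
  · by_contra hr
    refine h (rel_bot_top hab ?_ ?_)
    · rintro rfl
      exact hr (Or.inl rfl)
    · rintro x y rfl rfl
      exact hr (Or.inr ⟨x, y, hab, rfl, rfl⟩)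

end ThreePointSum

open ThreePointSum in
/-- A lattice with a unique lower cover `m` of the top inherits representations from the ideal
generated by `m`. -/
theorem Representable.of_Iic {D : Type*} [Lattice D] [BoundedOrder D] {m : D} (hm : m < ⊤)
    (hD : ∀ x, x ≤ m ∨ x = ⊤) {Q : Set D} (hbot : ⊥ ∈ Q) (htop : ⊤ ∈ Q)
    (h : Representable (Set.Iic m) (Subtype.val ⁻¹' Q)) : Representable D Q := by
  classical
  obtain ⟨L, _, _, φ, hφ⟩ := h
  let d : ThreePointSum L → ThreePointSum L → D
    | mid x, mid y => φ (LatCon.princ x y)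
    | a, b => if a = b then ⊥ else ⊤
  have hdne : ∀ a b, a ≠ b → (∀ x y, a = mid x → b ≠ mid y) → d a b = ⊤ := by
    rintro (_ | _ | x | i) (_ | _ | y | j) hab hmid
    all_goals first | exact if_neg hab | exact absurd rfl (hmid _ _ rfl)
  have hdself : ∀ a e, d a a ≤ e := by
    rintro (_ | _ | x | i) e
    · exact (if_pos rfl).trans_le bot_le
    · exact (if_pos rfl).trans_le bot_le
    · have : φ (LatCon.princ x x) ≤ ⟨e ⊓ m, inf_le_right⟩ := by
        rw [← φ.le_symm_apply, LatCon.princ_le_iff]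
        exact LatCon.refl _ x
      exact le_trans (show _ ≤ e ⊓ m from this) inf_le_left
    · exact (if_pos rfl).trans_le bot_le
  let κ : D → LatCon (ThreePointSum L) := fun e =>
    if he : e ≤ m then extend (φ.symm ⟨e, he⟩) else ⊤
  have hκ : ∀ e a b, (κ e).r a b ↔ d a b ≤ e := by
    intro e a b
    by_cases he : e ≤ m
    · simp only [κ, dif_pos he]
      constructor
      · rintro (rfl | ⟨x, y, hxy, rfl, rfl⟩)
        · exact hdself a e
        · rw [← LatCon.princ_le_iff, φ.le_symm_apply] at hxy
          exact hxy
      · intro hab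
        by_contra hr
        refine (hm.trans_le ((hdne a b ?_ ?_).symm.trans_le (hab.trans he))).false
        · rintro rfl
          exact hr (Or.inl rfl)
        · rintro x y rfl rfl
          refine hr (Or.inr ⟨x, y, ?_, rfl, rfl⟩)
          rw [← LatCon.princ_le_iff, φ.le_symm_apply]
          exact hab
    · refine iff_of_true ?_ (((hD e).resolve_left he).symm ▸ le_top)
      simp only [κ, dif_neg he]
      exact (le_top : LatCon.princ a b ≤ ⊤) a b (LatCon.princ_rel a b)
  have hbt : d bot top = ⊤ := if_neg nofun
  convert LatCon.representable_range d κ hκ ?_ ?_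
  · ext x
    constructor
    · intro hx
      rcases hD x with hxm | rfl
      · have hx' : (⟨x, hxm⟩ : Set.Iic m) ∈ φ '' Princ L := hφ ▸ hx
        obtain ⟨_, ⟨a, b, rfl⟩, hab⟩ := hx'
        exact ⟨mid a, mid b, congrArg Subtype.val hab⟩
      · exact ⟨bot, top, hbt⟩
    · rintro ⟨a, b, rfl⟩
      by_cases hab : a = b
      · subst hab
        rwa [bot_unique (hdself a ⊥)]
      by_cases hmid : ∃ x y, a = mid x ∧ b = mid y
      · obtain ⟨x, y, rfl, rfl⟩ := hmid
        have : φ (LatCon.princ x y) ∈ (Subtype.val ⁻¹' Q : Set (Set.Iic m)) :=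
          hφ ▸ ⟨_, ⟨x, y, rfl⟩, rfl⟩
        exact this
      · rwa [hdne a b hab fun x y hx hy => hmid ⟨x, y, hx, hy⟩]
  · intro e f hef
    rcases hD e with he | rfl
    · rcases hD f with hf | rfl
      · suffices φ.symm ⟨e, he⟩ ≤ φ.symm ⟨f, hf⟩ from φ.symm.le_iff_le.1 this
        intro x y hxy
        rw [← LatCon.princ_le_iff, φ.le_symm_apply] at hxy ⊢
        exact hef (mid x) (mid y) hxy
      · exact le_top
    · exact hbt.ge.trans (hef bot top le_top)
  · intro θ
    by_cases h : θ.r bot top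
    · refine ⟨⊤, LatCon.ext' fun a b => ⟨fun _ => ?_, fun _ => (hκ _ _ _).2 le_top⟩⟩
      exact LatCon.rel_of_rel_inf_sup (LatCon.rel_of_le h (sup_eq_right.1 (bot_max _)) inf_le_sup
        (sup_eq_right.1 (max_top _)))
    · refine ⟨φ (restrict θ), ?_⟩
      have hle : (φ (restrict θ) : D) ≤ m := (φ (restrict θ)).2
      calc κ (φ (restrict θ)) = extend (φ.symm (φ (restrict θ))) := dif_pos hle
        _ = θ := by rw [φ.symm_apply_apply, extend_restrict h]

namespace LatCon

variable {L : Type*} [Lattice L]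

/-- A common upper bound of a family of congruences. -/
def chain {ι : Type*} (θ : ι → LatCon L) : LatCon L :=
  ofUnary (Relation.ReflTransGen fun a b => ∃ i, (θ i).r a b)
    (fun _ => .refl)
    (fun _ _ h =>
      have : Std.Symm fun a b => ∃ i, (θ i).r a b := ⟨fun _ _ ⟨i, hi⟩ => ⟨i, (θ i).symm hi⟩⟩
      Relation.ReflTransGen.stdSymm.symm _ _ h)
    (fun _ _ _ => .trans)
    (fun _ _ c h => Relation.ReflTransGen.lift (· ⊔ c)
      (fun _ _ ⟨i, hi⟩ => ⟨i, (θ i).sup_comp hi ((θ i).refl c)⟩) _ _ h)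
    (fun _ _ c h => Relation.ReflTransGen.lift (· ⊓ c)
      (fun _ _ ⟨i, hi⟩ => ⟨i, (θ i).inf_comp hi ((θ i).refl c)⟩) _ _ h)

theorem le_chain {ι : Type*} (θ : ι → LatCon L) (i : ι) : θ i ≤ chain θ :=
  fun _ _ h => .single ⟨i, h⟩

theorem exists_rel_of_chain_rel {ι : Type*} {θ : ι → LatCon L} {x y : L} (h : (chain θ).r x y)
    (hxy : x ⋖ y) : ∃ i, (θ i).r x y := by
  have hπ : ∀ w, (w ⊔ x) ⊓ y = x ∨ (w ⊔ x) ⊓ y = y := fun w =>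
    hxy.wcovBy.eq_or_eq (le_inf le_sup_right hxy.le) inf_le_right
  have key : ∀ w, Relation.ReflTransGen (fun a b => ∃ i, (θ i).r a b) x w →
      (w ⊔ x) ⊓ y = x ∨ ∃ i, (θ i).r x y := by
    intro w hw
    induction hw with
    | refl => exact Or.inl (by simp [hxy.le])
    | @tail b c _ hbc ih =>
      obtain ⟨i, hi⟩ := hbc
      refine ih.elim (fun hb => (hπ c).imp_right fun hc => ⟨i, ?_⟩) Or.inr
      have := (θ i).inf_comp ((θ i).sup_comp hi ((θ i).refl x)) ((θ i).refl y)
      rwa [hb, hc] at this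
  refine (key y h).resolve_left ?_
  simpa [hxy.le] using hxy.ne'

end LatCon

theorem Set.subsingleton_of_supIrred {α : Type*} {s : Set α} (hs : SupIrred s) :
    s.Subsingleton := by
  intro a ha b hb
  by_contra hab
  have h : {a} ⊔ s \ {a} = s := Set.union_sdiff_cancel (Set.singleton_subset_iff.2 ha)
  rcases hs.2 h with h | h
  · exact hab (h ▸ hb : b ∈ ({a} : Set α)).symm
  · exact (h.ge ha).2 rfl

theorem eq_top_or_eq_top_of_mem_Jplus {A B : Set (Fin 3)} (hA : A ∈ Jplus (Set (Fin 3)))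
    (hB : B ∈ Jplus (Set (Fin 3))) (h : A ⊔ B = ⊤) : A = ⊤ ∨ B = ⊤ := by
  have key : ∀ C ∈ Jplus (Set (Fin 3)), C ≠ ⊤ → C.Subsingleton := by
    rintro C ((rfl | rfl) | hC) hne
    · exact Set.subsingleton_empty
    · exact absurd rfl hne
    · exact Set.subsingleton_of_supIrred hC
  by_contra! hne
  have hA' := key A hA hne.1
  have hB' := key B hB hne.2
  have hmem : ∀ i, i ∈ A ∨ i ∈ B := fun i => (h ▸ Set.mem_univ i : i ∈ A ⊔ B)
  have h01 : ¬ (0 : Fin 3) = 1 := by decide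
  have h02 : ¬ (0 : Fin 3) = 2 := by decide
  have h12 : ¬ (1 : Fin 3) = 2 := by decide
  rcases hmem 0 with h0 | h0 <;> rcases hmem 1 with h1 | h1 <;> rcases hmem 2 with h2 | h2
  all_goals first
    | exact h01 (hA' h0 h1) | exact h02 (hA' h0 h2) | exact h12 (hA' h1 h2)
    | exact h01 (hB' h0 h1) | exact h02 (hB' h0 h2) | exact h12 (hB' h1 h2)

theorem not_fullyRepresentable_set_fin_three : ¬ FullyRepresentable (Set (Fin 3)) := by
  intro hrep
  obtain ⟨L, _, _, φ, hφ⟩ := hrep (Jplus _) subset_rfl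
  have hmem : ∀ a b : L, φ (LatCon.princ a b) ∈ Jplus (Set (Fin 3)) := fun a b =>
    hφ ▸ ⟨_, ⟨a, b, rfl⟩, rfl⟩
  have hle : ∀ (a b : L) S, φ (LatCon.princ a b) ≤ S ↔ (φ.symm S).r a b := fun a b S => by
    rw [← LatCon.princ_le_iff, φ.le_symm_apply]
  have hcov : ∃ x y : L, x ⋖ y ∧ φ (LatCon.princ x y) = ⊤ := by
    obtain ⟨_, ⟨a, b, rfl⟩, hab⟩ : (⊤ : Set (Fin 3)) ∈ φ '' Princ L := hφ ▸ Or.inl (Or.inr rfl)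
    obtain ⟨⟨x, y⟩, ⟨hxy, htop⟩, hmin⟩ :=
      (measure fun p : L × L => (Set.Icc p.1 p.2).ncard).wf.has_min
        {p | p.1 ≤ p.2 ∧ φ (LatCon.princ p.1 p.2) = ⊤} ⟨(a ⊓ b, a ⊔ b), inf_le_sup, by
          rw [← top_le_iff, ← hab, hle]
          exact LatCon.rel_of_rel_inf_sup ((hle _ _ _).1 le_rfl)⟩
    dsimp only at hxy htop
    refine ⟨x, y, ⟨hxy.lt_of_ne ?_, fun z hxz hzy => ?_⟩, htop⟩
    · rintro rfl
      have : (⊤ : Set (Fin 3)) ≤ ∅ := htop ▸ (hle x x ∅).2 (LatCon.refl _ x)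
      exact this (Set.mem_univ 0)
    · have hsup : φ (LatCon.princ x z) ⊔ φ (LatCon.princ z y) = ⊤ := by
        rw [← top_le_iff, ← htop, hle]
        exact LatCon.trans _ ((hle _ _ _).1 le_sup_left) ((hle _ _ _).1 le_sup_right)
      rcases eq_top_or_eq_top_of_mem_Jplus (hmem x z) (hmem z y) hsup with h | h
      · refine hmin (x, z) ⟨hxz.le, h⟩ (Set.ncard_lt_ncard ⟨Set.Icc_subset_Icc_right hzy.le, ?_⟩)
        exact fun h => hzy.not_ge (h (Set.right_mem_Icc.2 hxy)).2
      · refine hmin (z, y) ⟨hzy.le, h⟩ (Set.ncard_lt_ncard ⟨Set.Icc_subset_Icc_left hxz.le, ?_⟩)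
        exact fun h => hxz.not_ge (h (Set.left_mem_Icc.2 hxy)).1
  obtain ⟨x, y, hxy, htop⟩ := hcov
  let θ : Fin 3 → LatCon L := fun i => φ.symm {i}
  have hchain : φ (LatCon.chain θ) = ⊤ := by
    refine top_unique fun i _ => ?_
    have : ({i} : Set (Fin 3)) ≤ φ (LatCon.chain θ) := by
      rw [← φ.symm_apply_le]
      exact LatCon.le_chain θ i
    exact this rfl
  have hr : (LatCon.chain θ).r x y := by
    rw [← LatCon.princ_le_iff, ← φ.le_iff_le, hchain]
    exact le_top
  obtain ⟨i, hi⟩ := LatCon.exists_rel_of_chain_rel hr hxy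
  have hi' : (⊤ : Set (Fin 3)) ≤ {i} := htop ▸ (hle x y {i}).2 hi
  have h0 : (0 : Fin 3) = i := hi' (Set.mem_univ 0)
  have h1 : (1 : Fin 3) = i := hi' (Set.mem_univ 1)
  exact absurd (h0.trans h1.symm) (by decide)

open LatTable (rel)

/-- The sets closed downwards with respect to `rel rows`. -/
def lowerFinsets (k : ℕ) (rows : List ℕ) : Finset (Finset (Fin k)) :=
  Finset.univ.filter fun S => ∀ i j, rel rows i j → j ∈ S → i ∈ S

section Count

variable {D : Type*} [DistribLattice D] [BoundedOrder D] {k : ℕ} {rows : List ℕ} {f : Fin k → D}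

theorem sup_injOn_lowerFinsets (hf : ∀ i, SupIrred (f i))
    (hrel : ∀ i j, f i ≤ f j ↔ rel rows i j) :
    Set.InjOn (fun S : Finset (Fin k) => S.sup f) (lowerFinsets k rows) := by
  have key : ∀ S ∈ lowerFinsets k rows, ∀ i, f i ≤ S.sup f ↔ i ∈ S := by
    refine fun S hS i => ⟨fun h => ?_, fun h => Finset.le_sup h⟩
    obtain ⟨j, hj, hij⟩ := (hf i).supPrime.le_finset_sup.1 h
    exact (Finset.mem_filter.1 hS).2 i j ((hrel i j).1 hij) hj
  intro S hS T hT hST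
  ext i
  rw [← key S hS, ← key T hT, show S.sup f = T.sup f from hST]

variable [Fintype D]

theorem card_lowerFinsets_le (hf : ∀ i, SupIrred (f i))
    (hrel : ∀ i j, f i ≤ f j ↔ rel rows i j) : (lowerFinsets k rows).card ≤ Fintype.card D :=
  Finset.card_le_card_of_injOn _ (fun _ _ => Finset.mem_univ _) (sup_injOn_lowerFinsets hf hrel)

theorem exists_eq_of_card_le (hf : ∀ i, SupIrred (f i))
    (hrel : ∀ i j, f i ≤ f j ↔ rel rows i j) (hD : Fintype.card D ≤ (lowerFinsets k rows).card)
    {x : D} (hx : SupIrred x) : ∃ i, f i = x := by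
  obtain ⟨S, -, hS⟩ := Finset.surjOn_of_injOn_of_card_le _ (fun _ _ => Finset.mem_univ _)
    (sup_injOn_lowerFinsets hf hrel) hD (Finset.mem_univ x)
  obtain ⟨i, -, hi⟩ := hx.finset_sup_eq hS
  exact ⟨i, hi⟩

end Count

/-- `rel rows` describes the order on `S`. -/
inductive IsModeled {D : Type*} [LE D] (S : Set D) (k : ℕ) (rows : List ℕ) : Prop
  | intro (f : Fin k → D) (mem_iff : ∀ x, x ∈ S ↔ ∃ j, f j = x)
    (le_iff : ∀ i j, f i ≤ f j ↔ rel rows i j)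

theorem isModeled_of_forall {D : Type*} [LE D] {S : Set D} {k : ℕ} {rows : List ℕ} {f : Fin k → D}
    (hrel : ∀ i j, f i ≤ f j ↔ rel rows i j) (hf : ∀ j, f j ∈ S) (hS : ∀ x ∈ S, ∃ j, f j = x) :
    IsModeled S k rows :=
  ⟨f, fun x => ⟨hS x, by rintro ⟨j, rfl⟩; exact hf j⟩, hrel⟩

theorem exists_least {D : Type*} [PartialOrder D] [Finite D] {R : Set D} (hne : R.Nonempty)
    (hch : ∀ x ∈ R, ∀ y ∈ R, x ≤ y ∨ y ≤ x) :
    ∃ x ∈ R, ∀ y ∈ R, x ≤ y := by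
  obtain ⟨x, hx⟩ := R.toFinite.exists_minimal hne
  exact ⟨x, hx.1, fun y hy => (hch x hx.1 y hy).elim id (hx.2 hy)⟩

section Classification

variable {D : Type*} [DistribLattice D] [BoundedOrder D] [Fintype D] {S : Set D}

theorem false_of_eight_le (hD : Fintype.card D ≤ 7) (hS : ∀ x ∈ S, SupIrred x) {k : ℕ}
    {rows : List ℕ} {f : Fin k → D} (hrel : ∀ i j, f i ≤ f j ↔ rel rows i j) (hf : ∀ j, f j ∈ S)
    (h : 8 ≤ (lowerFinsets k rows).card) : False := by
  have := card_lowerFinsets_le (fun i => hS _ (hf i)) hrel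
  omega

theorem isModeled_of_seven_le (hD : Fintype.card D ≤ 7) (hS : ∀ x ∈ S, SupIrred x) {k : ℕ}
    {rows : List ℕ} {f : Fin k → D} (hrel : ∀ i j, f i ≤ f j ↔ rel rows i j) (hf : ∀ j, f j ∈ S)
    (h : 7 ≤ (lowerFinsets k rows).card) : (∀ x, SupIrred x → x ∈ S) ∧ IsModeled S k rows := by
  have hex : ∀ x, SupIrred x → ∃ j, f j = x := fun x hx =>
    exists_eq_of_card_le (fun i => hS _ (hf i)) hrel (hD.trans h) hx
  refine ⟨fun x hx => ?_, isModeled_of_forall hrel hf fun x hx => hex x (hS x hx)⟩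
  obtain ⟨j, rfl⟩ := hex x hx
  exact hf j

theorem le_or_le_of_maximal (hD : Fintype.card D ≤ 7) (hS : ∀ x ∈ S, SupIrred x) {p q : D}
    (hp : Maximal (· ∈ S) p) (hq : Maximal (· ∈ S) q) (hpq : p ≠ q) {x : D} (hx : x ∈ S) :
    x ≤ p ∨ x ≤ q := by
  by_contra! h
  have hpx : ¬ p ≤ x := fun hpx => h.1 (hp.2 hx hpx)
  have hqx : ¬ q ≤ x := fun hqx => h.2 (hq.2 hx hqx)
  have hpq' : ¬ p ≤ q := fun h => hpq (le_antisymm h (hp.2 hq.1 h))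
  have hqp' : ¬ q ≤ p := fun h => hpq (le_antisymm (hq.2 hp.1 h) h)
  obtain ⟨hxp, hxq⟩ := h
  have hrel : ∀ i j, ![x, p, q] i ≤ ![x, p, q] j ↔ rel [1, 2, 4] i j := by
    intro i j
    fin_cases i <;> fin_cases j <;> first
      | exact iff_of_true (by dsimp; order) (by decide)
      | exact iff_of_false (by dsimp; order) (by decide)
  exact false_of_eight_le hD hS hrel (by simp [Fin.forall_fin_succ, hx, hp.1, hq.1])
    (by decide +kernel)

/-- Two maximal elements above all the other elements. -/
theorem classify_of_le (hD : Fintype.card D ≤ 7) (hS : ∀ x ∈ S, SupIrred x) {p q : D}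
    (hp : Maximal (· ∈ S) p) (hq : Maximal (· ∈ S) q) (hpq : p ≠ q)
    (hle : ∀ x ∈ S, x ≠ p → x ≠ q → x ≤ p ∧ x ≤ q) :
    IsModeled S 2 [1, 2] ∨ IsModeled S 3 [1, 3, 5] ∨ IsModeled S 4 [1, 3, 7, 11] ∨
      (∀ x, SupIrred x → x ∈ S) ∧
        (IsModeled S 5 [1, 3, 7, 15, 23] ∨ IsModeled S 4 [1, 2, 7, 11]) := by
  have hpq' : ¬ p ≤ q := fun h => hpq (le_antisymm h (hp.2 hq.1 h))
  have hqp' : ¬ q ≤ p := fun h => hpq (le_antisymm (hq.2 hp.1 h) h)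
  have hlt : ∀ x ∈ S, x ≠ p → x ≠ q → x < p ∧ x < q := fun x hx hxp hxq =>
    ⟨(hle x hx hxp hxq).1.lt_of_ne hxp, (hle x hx hxp hxq).2.lt_of_ne hxq⟩
  by_cases hch : ∀ x ∈ S \ {p, q}, ∀ y ∈ S \ {p, q}, x ≤ y ∨ y ≤ x
  swap
  · push Not at hch
    obtain ⟨x, ⟨hx, hx'⟩, y, ⟨hy, hy'⟩, hxy, hyx⟩ := hch
    simp only [Set.mem_insert_iff, Set.mem_singleton_iff, not_or] at hx' hy'
    obtain ⟨hxp, hxq⟩ := hlt x hx hx'.1 hx'.2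
    obtain ⟨hyp, hyq⟩ := hlt y hy hy'.1 hy'.2
    have hrel : ∀ i j, ![x, y, p, q] i ≤ ![x, y, p, q] j ↔ rel [1, 2, 7, 11] i j := by
      intro i j
      fin_cases i <;> fin_cases j <;> first
        | exact iff_of_true (by dsimp; order) (by decide)
        | exact iff_of_false (by dsimp; order) (by decide)
    have := isModeled_of_seven_le hD hS hrel
      (by simp [Fin.forall_fin_succ, hx, hy, hp.1, hq.1]) (by decide +kernel)
    exact Or.inr (Or.inr (Or.inr ⟨this.1, Or.inr this.2⟩))
  by_cases h₀ : (S \ {p, q}).Nonempty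
  swap
  · left
    have hrel : ∀ i j, ![p, q] i ≤ ![p, q] j ↔ rel [1, 2] i j := by
      intro i j
      fin_cases i <;> fin_cases j <;> first
        | exact iff_of_true (by dsimp; order) (by decide)
        | exact iff_of_false (by dsimp; order) (by decide)
    refine isModeled_of_forall hrel (by simp [Fin.forall_fin_succ, hp.1, hq.1]) fun x hx => ?_
    by_contra! hne
    exact h₀ ⟨x, hx, by simpa [Fin.forall_fin_succ, eq_comm] using hne⟩
  obtain ⟨x, hx, hxmin⟩ := exists_least h₀ hch
  have hx' := hx.2
  simp only [Set.mem_insert_iff, Set.mem_singleton_iff, not_or] at hx'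
  obtain ⟨hxp, hxq⟩ := hlt x hx.1 hx'.1 hx'.2
  by_cases h₁ : ((S \ {p, q}) \ {x}).Nonempty
  swap
  · right; left
    have hrel : ∀ i j, ![x, p, q] i ≤ ![x, p, q] j ↔ rel [1, 3, 5] i j := by
      intro i j
      fin_cases i <;> fin_cases j <;> first
        | exact iff_of_true (by dsimp; order) (by decide)
        | exact iff_of_false (by dsimp; order) (by decide)
    refine isModeled_of_forall hrel (by simp [Fin.forall_fin_succ, hx.1, hp.1, hq.1])
      fun y hy => ?_
    by_contra! hne
    exact h₁ ⟨y, ⟨hy, by simp_all [Fin.forall_fin_succ, eq_comm]⟩,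
      by simp_all [Fin.forall_fin_succ, eq_comm]⟩
  obtain ⟨y, hy, hymin⟩ := exists_least h₁ fun u hu v hv => hch u hu.1 v hv.1
  have hy' := hy.1.2
  simp only [Set.mem_insert_iff, Set.mem_singleton_iff, not_or] at hy'
  obtain ⟨hyp, hyq⟩ := hlt y hy.1.1 hy'.1 hy'.2
  have hxy : x < y := (hxmin y hy.1).lt_of_ne fun h => hy.2 h.symm
  by_cases h₂ : (((S \ {p, q}) \ {x}) \ {y}).Nonempty
  swap
  · right; right; left
    have hrel : ∀ i j, ![x, y, p, q] i ≤ ![x, y, p, q] j ↔ rel [1, 3, 7, 11] i j := by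
      intro i j
      fin_cases i <;> fin_cases j <;> first
        | exact iff_of_true (by dsimp; order) (by decide)
        | exact iff_of_false (by dsimp; order) (by decide)
    refine isModeled_of_forall hrel (by simp [Fin.forall_fin_succ, hx.1, hy.1.1, hp.1, hq.1])
      fun z hz => ?_
    by_contra! hne
    exact h₂ ⟨z, ⟨⟨hz, by simp_all [Fin.forall_fin_succ, eq_comm]⟩,
      by simp_all [Fin.forall_fin_succ, eq_comm]⟩, by simp_all [Fin.forall_fin_succ, eq_comm]⟩
  obtain ⟨z, hz⟩ := h₂
  have hz' := hz.1.1.2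
  simp only [Set.mem_insert_iff, Set.mem_singleton_iff, not_or] at hz'
  obtain ⟨hzp, hzq⟩ := hlt z hz.1.1.1 hz'.1 hz'.2
  have hyz : y < z := (hymin z hz.1).lt_of_ne fun h => hz.2 h.symm
  have hrel : ∀ i j, ![x, y, z, p, q] i ≤ ![x, y, z, p, q] j ↔ rel [1, 3, 7, 15, 23] i j := by
    intro i j
    fin_cases i <;> fin_cases j <;> first
      | exact iff_of_true (by dsimp; order) (by decide)
      | exact iff_of_false (by dsimp; order) (by decide)
  have := isModeled_of_seven_le hD hS hrel
    (by simp [Fin.forall_fin_succ, hx.1, hy.1.1, hz.1.1.1, hp.1, hq.1]) (by decide +kernel)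
  exact Or.inr (Or.inr (Or.inr ⟨this.1, Or.inl this.2⟩))

/-- Two maximal elements, one of which is not above some other element. -/
theorem classify_of_not_le (hD : Fintype.card D ≤ 7) (hS : ∀ x ∈ S, SupIrred x) {p q r : D}
    (hp : Maximal (· ∈ S) p) (hq : Maximal (· ∈ S) q) (hpq : p ≠ q) (hr : r ∈ S) (hrq : r ≠ q)
    (hrp : ¬ r ≤ p) :
    IsModeled S 3 [1, 3, 4] ∨ (∀ x, SupIrred x → x ∈ S) ∧ IsModeled S 4 [1, 3, 7, 9] := by
  have hpq' : ¬ p ≤ q := fun h => hpq (le_antisymm h (hp.2 hq.1 h))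
  have hqp' : ¬ q ≤ p := fun h => hpq (le_antisymm (hq.2 hp.1 h) h)
  have hor : ∀ x ∈ S, x ≤ p ∨ x ≤ q := fun x => le_or_le_of_maximal hD hS hp hq hpq
  replace hrq : r < q := ((hor r hr).resolve_left hrp).lt_of_ne hrq
  by_cases hz : ∃ z ∈ S, z ≠ r ∧ z ≠ q ∧ z ≠ p
  swap
  · left
    have hrel : ∀ i j, ![r, q, p] i ≤ ![r, q, p] j ↔ rel [1, 3, 4] i j := by
      intro i j
      fin_cases i <;> fin_cases j <;> first
        | exact iff_of_true (by dsimp; order) (by decide)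
        | exact iff_of_false (by dsimp; order) (by decide)
    refine isModeled_of_forall hrel (by simp [Fin.forall_fin_succ, hr, hp.1, hq.1]) fun x hx => ?_
    by_contra! hne
    exact hz ⟨x, hx, by simpa [Fin.forall_fin_succ, eq_comm] using hne⟩
  obtain ⟨z, hz, hzr, hzq, hzp⟩ := hz
  by_cases hzp' : z ≤ p
  · replace hzp : z < p := hzp'.lt_of_ne hzp
    have hrz : ¬ r ≤ z := fun h => hrp (h.trans hzp')
    by_cases hzr' : z ≤ r
    · have hrel : ∀ i j, ![z, r, q, p] i ≤ ![z, r, q, p] j ↔ rel [1, 3, 7, 9] i j := by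
        intro i j
        fin_cases i <;> fin_cases j <;> first
          | exact iff_of_true (by dsimp; order) (by decide)
          | exact iff_of_false (by dsimp; order) (by decide)
      exact Or.inr (isModeled_of_seven_le hD hS hrel
        (by simp [Fin.forall_fin_succ, hr, hz, hp.1, hq.1]) (by decide +kernel))
    exfalso
    by_cases hzq' : z ≤ q
    · have hrel : ∀ i j, ![r, z, q, p] i ≤ ![r, z, q, p] j ↔ rel [1, 2, 7, 10] i j := by
        intro i j
        fin_cases i <;> fin_cases j <;> first
          | exact iff_of_true (by dsimp; order) (by decide)
          | exact iff_of_false (by dsimp; order) (by decide)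
      exact false_of_eight_le hD hS hrel
        (by simp [Fin.forall_fin_succ, hr, hz, hp.1, hq.1]) (by decide +kernel)
    · have hrel : ∀ i j, ![r, z, q, p] i ≤ ![r, z, q, p] j ↔ rel [1, 2, 5, 10] i j := by
        intro i j
        fin_cases i <;> fin_cases j <;> first
          | exact iff_of_true (by dsimp; order) (by decide)
          | exact iff_of_false (by dsimp; order) (by decide)
      exact false_of_eight_le hD hS hrel
        (by simp [Fin.forall_fin_succ, hr, hz, hp.1, hq.1]) (by decide +kernel)
  · exfalso
    have hzq' : z < q := ((hor z hz).resolve_left hzp').lt_of_ne hzq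
    by_cases hzr' : z ≤ r
    · have hrel : ∀ i j, ![z, r, q, p] i ≤ ![z, r, q, p] j ↔ rel [1, 3, 7, 8] i j := by
        intro i j
        fin_cases i <;> fin_cases j <;> first
          | exact iff_of_true (by dsimp; order) (by decide)
          | exact iff_of_false (by dsimp; order) (by decide)
      exact false_of_eight_le hD hS hrel
        (by simp [Fin.forall_fin_succ, hr, hz, hp.1, hq.1]) (by decide +kernel)
    by_cases hrz : r ≤ z
    · have hrel : ∀ i j, ![r, z, q, p] i ≤ ![r, z, q, p] j ↔ rel [1, 3, 7, 8] i j := by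
        intro i j
        fin_cases i <;> fin_cases j <;> first
          | exact iff_of_true (by dsimp; order) (by decide)
          | exact iff_of_false (by dsimp; order) (by decide)
      exact false_of_eight_le hD hS hrel
        (by simp [Fin.forall_fin_succ, hr, hz, hp.1, hq.1]) (by decide +kernel)
    · have hrel : ∀ i j, ![r, z, p] i ≤ ![r, z, p] j ↔ rel [1, 2, 4] i j := by
        intro i j
        fin_cases i <;> fin_cases j <;> first
          | exact iff_of_true (by dsimp; order) (by decide)
          | exact iff_of_false (by dsimp; order) (by decide)
      exact false_of_eight_le hD hS hrel
        (by simp [Fin.forall_fin_succ, hr, hz, hp.1]) (by decide +kernel)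

theorem classify (hD : Fintype.card D ≤ 7) (hS : ∀ x ∈ S, SupIrred x) {p q : D}
    (hp : Maximal (· ∈ S) p) (hq : Maximal (· ∈ S) q) (hpq : p ≠ q) :
    IsModeled S 2 [1, 2] ∨ IsModeled S 3 [1, 3, 5] ∨ IsModeled S 4 [1, 3, 7, 11] ∨
      IsModeled S 3 [1, 3, 4] ∨ (∀ x, SupIrred x → x ∈ S) ∧
        (IsModeled S 5 [1, 3, 7, 15, 23] ∨ IsModeled S 4 [1, 2, 7, 11] ∨
          IsModeled S 4 [1, 3, 7, 9]) := by
  by_cases hle : ∀ x ∈ S, x ≠ p → x ≠ q → x ≤ p ∧ x ≤ q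
  · have := classify_of_le hD hS hp hq hpq hle
    tauto
  · push Not at hle
    obtain ⟨r, hr, hrp, hrq, hle⟩ := hle
    by_cases h : r ≤ p
    · have := classify_of_not_le hD hS hq hp hpq.symm hr hrp (hle h)
      tauto
    · have := classify_of_not_le hD hS hp hq hpq hr hrq h
      tauto

end Classification

theorem exists_two_maximal {D : Type*} [Lattice D] [OrderBot D] [Finite D] {S : Set D} {m : D}
    (hm : IsLUB S m) (hmS : m ∉ S) (hbot : m ≠ ⊥) :
    ∃ p q, Maximal (· ∈ S) p ∧ Maximal (· ∈ S) q ∧ p ≠ q := by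
  have hne : S.Nonempty := by
    rw [Set.nonempty_iff_ne_empty]
    rintro rfl
    exact hbot (isLUB_empty_iff.1 hm).eq_bot
  obtain ⟨p, hp⟩ := S.toFinite.exists_maximal hne
  obtain ⟨x, hx, hxp⟩ : ∃ x ∈ S, ¬ x ≤ p := by
    by_contra! h
    exact hmS (hm.unique ⟨h, fun u hu => hu hp.1⟩ ▸ hp.1)
  obtain ⟨q, hxq, hq⟩ := S.toFinite.exists_le_maximal hx
  exact ⟨p, q, hp, hq, fun h => hxp (h ▸ hxq)⟩

theorem IsModeled.snoc_top {D : Type*} [DistribLattice D] [BoundedOrder D] {S : Set D} {m : D}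
    {k : ℕ} {rows rows' : List ℕ} (h : IsModeled S k rows)
    (hS : ∀ x, SupIrred x ↔ x ∈ S ∨ x = ⊤) (hm : IsLUB S m) (htop : ⊤ ∉ S)
    (hrows : (∀ i j : Fin k, rel rows' i.castSucc j.castSucc ↔ rel rows i j) ∧
      (∀ i, rel rows' i (Fin.last k)) ∧ ∀ j : Fin k, ¬ rel rows' (Fin.last k) j.castSucc) :
    ∃ f : Fin (k + 1) → D, (∀ x, SupIrred x ↔ ∃ j, f j = x) ∧
      (∀ i j, f i ≤ f j ↔ rel rows' i j) ∧
      ∀ T, T = Finset.univ.map Fin.castSuccEmb → T.sup f = m := by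
  obtain ⟨f, hf, hrel⟩ := h
  refine ⟨Fin.snoc f ⊤, fun x => ?_, fun i j => ?_, ?_⟩
  · rw [hS, hf, Fin.exists_fin_succ']
    simp [eq_comm]
  · refine Fin.lastCases ?_ (fun j => ?_) j
    · simpa using hrows.2.1 i
    · refine Fin.lastCases ?_ (fun i => ?_) i
      · refine iff_of_false ?_ (hrows.2.2 j)
        simp only [Fin.snoc_last, Fin.snoc_castSucc, top_le_iff]
        exact fun h => htop ((hf _).2 ⟨j, h⟩)
      · simpa using (hrel i j).trans (hrows.1 i j).symm
  · rintro _ rfl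
    rw [Finset.sup_map]
    refine IsLUB.unique ⟨?_, fun u hu => Finset.sup_le fun i _ => ?_⟩ hm
    · intro x hx
      obtain ⟨j, rfl⟩ := (hf x).1 hx
      refine le_trans ?_ (Finset.le_sup (Finset.mem_univ j))
      simp
    · simpa using hu ((hf _).2 ⟨i, rfl⟩)

theorem Representable.of_subsingleton {D : Type*} [Lattice D] [BoundedOrder D] [Subsingleton D]
    {Q : Set D} (hQ : ⊥ ∈ Q) : Representable D Q := by
  convert LatCon.representable_range (L := Unit) (fun _ _ => (⊥ : D)) (fun _ => ⊤) ?_ ?_ ?_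
  · ext x
    exact iff_of_true (Subsingleton.elim ⊥ x ▸ hQ) ⟨(), (), Subsingleton.elim _ _⟩
  · exact fun e a b => iff_of_true (LatCon.refl _ a) bot_le
  · exact fun e f _ => (Subsingleton.elim e f).le
  · exact fun θ => ⟨⊥, LatCon.ext' fun a b => iff_of_true (LatCon.refl _ a) (LatCon.refl _ a)⟩

/-- The case in which the top is not join-irreducible. -/
theorem representable_of_not_supIrred_top {D : Type*} [DistribLattice D] [BoundedOrder D]
    [Fintype D] (hD : Fintype.card D ≤ 7) (hbt : (⊤ : D) ≠ ⊥) (htop : ¬ SupIrred (⊤ : D))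
    {Q : Set D} (hQ : Jplus D ⊆ Q) : Representable D Q := by
  have hlub : IsLUB {x : D | SupIrred x} ⊤ := by
    refine ⟨fun _ _ => le_top, fun u hu => ?_⟩
    obtain ⟨s, hs, hs'⟩ := exists_supIrred_decomposition (⊤ : D)
    rw [← hs]
    exact Finset.sup_le fun x hx => hu (hs' hx)
  obtain ⟨p, q, hp, hq, hpq⟩ := exists_two_maximal hlub htop hbt
  obtain h | h | h | h | ⟨-, h | h | h⟩ := classify hD (fun _ => id) hp hq hpq
  all_goals obtain ⟨f, hf, hrel⟩ := h
  · exact LatTable.antichainTable_valid.representable f hf hrel hQ (by simp) (by simp)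
  · exact LatTable.antichainBotTable_valid.representable f hf hrel hQ (by simp) (by simp)
  · exact LatTable.antichainBotBotTable_valid.representable f hf hrel hQ (by simp) (by simp)
  · by_cases hS : ({0, 2} : Finset (Fin 3)).sup f ∈ Q
    · exact LatTable.pairTable_valid.representable f hf hrel hQ (by simp) (by simpa using hS)
    · exact LatTable.pairComplTable_valid.representable f hf hrel hQ (by simpa using hS) (by simp)
  · exact LatTable.antichainBotBotBotTable_valid.representable f hf hrel hQ (by simp) (by simp)
  · by_cases hS : ({0, 1} : Finset (Fin 4)).sup f ∈ Q
    · exact LatTable.twoAntichainsTable_valid.representable f hf hrel hQ (by simp)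
        (by simpa using hS)
    · exact LatTable.twoAntichainsComplTable_valid.representable f hf hrel hQ (by simpa using hS)
        (by simp)
  · by_cases hS : ({0, 1, 3} : Finset (Fin 4)).sup f ∈ Q
    · exact LatTable.pairBotTable_valid.representable f hf hrel hQ (by simp) (by simpa using hS)
    · exact LatTable.pairBotComplTable_valid.representable f hf hrel hQ (by simpa using hS)
        (by simp)

/-- The case in which the top is join-irreducible and its lower cover is not required to be
principal. -/
theorem representable_of_not_mem {D : Type*} [DistribLattice D] [BoundedOrder D] [Fintype D]
    (hD : Fintype.card D ≤ 7) (htop : SupIrred (⊤ : D)) {m : D}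
    (hm : IsLUB {x : D | SupIrred x ∧ x ≠ ⊤} m) {Q : Set D} (hQ : Jplus D ⊆ Q) (hmQ : m ∉ Q) :
    Representable D Q := by
  obtain ⟨p, q, hp, hq, hpq⟩ := exists_two_maximal hm (fun h => hmQ (hQ (Or.inr h.1)))
    fun h => hmQ (hQ (Or.inl (Or.inl h)))
  have hS : ∀ x, SupIrred x ↔ x ∈ {x : D | SupIrred x ∧ x ≠ ⊤} ∨ x = ⊤ := fun x => by
    rcases eq_or_ne x ⊤ with rfl | hx <;> simp [*]
  have htopS : (⊤ : D) ∉ {x : D | SupIrred x ∧ x ≠ ⊤} := fun h => h.2 rfl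
  obtain h | h | h | h | ⟨h, -⟩ := classify hD (fun _ => And.left) hp hq hpq
  · obtain ⟨f, hf, hrel, hsup⟩ := h.snoc_top (rows' := [1, 2, 7]) hS hm htopS (by decide)
    exact LatTable.antichainTopTable_valid.representable f hf hrel hQ
      (List.forall_mem_singleton.2 (by rwa [hsup {0, 1} (by decide)])) (by simp)
  · obtain ⟨f, hf, hrel, hsup⟩ := h.snoc_top (rows' := [1, 3, 5, 15]) hS hm htopS (by decide)
    exact LatTable.antichainBotTopTable_valid.representable f hf hrel hQ
      (List.forall_mem_singleton.2 (by rwa [hsup {0, 1, 2} (by decide)])) (by simp)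
  · obtain ⟨f, hf, hrel, hsup⟩ :=
      h.snoc_top (rows' := [1, 3, 7, 11, 31]) hS hm htopS (by decide)
    exact LatTable.antichainBotBotTopTable_valid.representable f hf hrel hQ
      (List.forall_mem_singleton.2 (by rwa [hsup {0, 1, 2, 3} (by decide)])) (by simp)
  · obtain ⟨f, hf, hrel, hsup⟩ := h.snoc_top (rows' := [1, 3, 4, 15]) hS hm htopS (by decide)
    by_cases hS : ({0, 2} : Finset (Fin 4)).sup f ∈ Q
    · exact LatTable.pairTopTable_valid.representable f hf hrel hQ
        (List.forall_mem_singleton.2 (by rwa [hsup {0, 1, 2} (by decide)]))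
        (List.forall_mem_singleton.2 hS)
    · exact LatTable.pairTopComplTable_valid.representable f hf hrel hQ
        (List.forall_mem_cons.2 ⟨by rwa [hsup {0, 1, 2} (by decide)],
          List.forall_mem_singleton.2 hS⟩)
        (by simp)
  · exact absurd rfl (h ⊤ htop).2

theorem exists_isLUB_supIrred {D : Type*} [DistribLattice D] [BoundedOrder D] [Finite D]
    (htop : SupIrred (⊤ : D)) :
    ∃ m, IsLUB {x : D | SupIrred x ∧ x ≠ ⊤} m ∧ m < ⊤ ∧ ∀ x, x ≤ m ∨ x = ⊤ := by
  have hfin : {x : D | SupIrred x ∧ x ≠ ⊤}.Finite := Set.toFinite _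
  have hlub : IsLUB {x : D | SupIrred x ∧ x ≠ ⊤} (hfin.toFinset.sup id) := by
    simpa using hfin.toFinset.isLUB_sup_id
  refine ⟨_, hlub, lt_top_iff_ne_top.2 fun h => ?_, fun x => or_iff_not_imp_right.2 fun hx => ?_⟩
  · obtain ⟨x, hx, rfl⟩ := htop.finset_sup_eq h
    exact (hfin.mem_toFinset.1 hx).2 rfl
  · obtain ⟨s, rfl, hs⟩ := exists_supIrred_decomposition x
    refine Finset.sup_le fun y hy => hlub.1 ⟨hs hy, ?_⟩
    rintro rfl
    exact hx (top_unique (Finset.le_sup (f := id) hy))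

theorem Jplus_Iic_subset {D : Type*} [Lattice D] [BoundedOrder D] {m : D} {Q : Set D}
    (hQ : Jplus D ⊆ Q) (hm : m ∈ Q) : Jplus (Set.Iic m) ⊆ Subtype.val ⁻¹' Q := by
  rintro x ((rfl | rfl) | hx)
  · exact hQ (Or.inl (Or.inl rfl))
  · exact hm
  · refine hQ (Or.inr ⟨fun h => hx.1 fun y _ => (h bot_le).trans bot_le, fun b c hbc => ?_⟩)
    have hb : b ≤ m := (le_sup_left.trans_eq hbc).trans x.2
    have hc : c ≤ m := (le_sup_right.trans_eq hbc).trans x.2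
    have := @hx.2 ⟨b, hb⟩ ⟨c, hc⟩ (Subtype.ext hbc)
    simpa [Subtype.ext_iff] using this

theorem fullyRepresentable_of_card_le_seven (D : Type u) [DistribLattice D] [Fintype D]
    [BoundedOrder D] (hD : Fintype.card D ≤ 7) : FullyRepresentable D := by
  intro Q hQ
  by_cases hbt : (⊤ : D) = ⊥
  · have := subsingleton_of_bot_eq_top hbt.symm
    exact .of_subsingleton (hQ (Or.inl (Or.inl rfl)))
  by_cases htop : SupIrred (⊤ : D)
  swap
  · exact representable_of_not_supIrred_top hD hbt htop hQ
  obtain ⟨m, hlub, hm, hle⟩ := exists_isLUB_supIrred htop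
  by_cases hmQ : m ∈ Q
  swap
  · exact representable_of_not_mem hD htop hlub hQ hmQ
  classical
  let _ : DistribLattice (Set.Iic m) :=
    { (inferInstance : Lattice (Set.Iic m)) with
      le_sup_inf := fun a b c => le_sup_inf (x := (a : D)) }
  have hcard : Fintype.card (Set.Iic m) < Fintype.card D :=
    Fintype.card_subtype_lt (x := ⊤) hm.not_ge
  exact .of_Iic hm hle (hQ (Or.inl (Or.inl rfl))) (hQ (Or.inl (Or.inr rfl)))
    (fullyRepresentable_of_card_le_seven (Set.Iic m) (hcard.le.trans hD) _
      (Jplus_Iic_subset hQ hmQ))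
termination_by Fintype.card D

decreasing_by exact hcard

/-- **Theorem 4.** The eight-element Boolean lattice `B₃ = Set (Fin 3)` is not fully
representable, while every finite distributive lattice with at most `7` elements is;
hence the smallest finite distributive lattice that is not fully representable has `8`
elements. -/
theorem smallest_not_fullyRepresentable_has_eight_elements :
    ¬ FullyRepresentable (Set (Fin 3)) ∧
    Fintype.card (Set (Fin 3)) = 8 ∧
    (∀ (D : Type) [DistribLattice D] [Fintype D] [BoundedOrder D],
      Fintype.card D ≤ 7 → FullyRepresentable D) := by
  exact ⟨not_fullyRepresentable_set_fin_three, by simp,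
    fun D _ _ _ hD => fullyRepresentable_of_card_le_seven D hD⟩
end

section
/- There exist a finite distributive lattice D and a principal congruence representable subset Q ⊆ D such that Q \ {⊤} is not a lower set (down-set) of D. -/
universe u

namespace LatCon

variable {n : ℕ}

/-- The congruence of the chain `Fin (n + 1)` collapsing exactly the covering pairs
`i.castSucc ⋖ i.succ` with `i ∈ S`. -/
def ofEdges (S : Set (Fin n)) : LatCon (Fin (n + 1)) where
  r a b := ∀ i ∉ S, (a ≤ i.castSucc ↔ b ≤ i.castSucc)
  refl _ _ _ := Iff.rfl
  symm h i hi := (h i hi).symm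
  trans h₁ h₂ i hi := (h₁ i hi).trans (h₂ i hi)
  sup_comp h₁ h₂ i hi := by rw [sup_le_iff, sup_le_iff, h₁ i hi, h₂ i hi]
  inf_comp h₁ h₂ i hi := by rw [inf_le_iff, inf_le_iff, h₁ i hi, h₂ i hi]

/-- The covering pairs of the chain `Fin (n + 1)` collapsed by a congruence. -/
def edges (θ : LatCon (Fin (n + 1))) : Set (Fin n) := {i | θ.r i.castSucc i.succ}

theorem edges_ofEdges (S : Set (Fin n)) : edges (ofEdges S) = S := by
  ext i
  constructor
  · intro h
    by_contra hi
    exact absurd ((h i hi).1 le_rfl) (by simp [Fin.le_def])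
  · intro hi j hj
    have hij : (i : ℕ) ≠ j := fun h => hj (Fin.ext h ▸ hi)
    simp only [Fin.le_def, Fin.val_castSucc, Fin.val_succ]
    omega

theorem mem_edges_of_r {θ : LatCon (Fin (n + 1))} {a b : Fin (n + 1)} {i : Fin n}
    (h : θ.r a b) (ha : a ≤ i.castSucc) (hb : ¬ b ≤ i.castSucc) : i ∈ edges θ := by
  have hb' : i.succ ≤ b := by
    simp only [Fin.le_def, Fin.val_castSucc, Fin.val_succ] at hb ⊢
    omega
  have hi : i.castSucc ≤ i.succ := by simp [Fin.le_def]
  have key := θ.inf_comp (θ.sup_comp h (θ.refl i.castSucc)) (θ.refl i.succ)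
  rwa [sup_eq_right.2 ha, inf_eq_left.2 hi, sup_eq_left.2 (hi.trans hb'),
    inf_eq_right.2 hb'] at key

theorem r_of_ofEdges_edges_of_le {θ : LatCon (Fin (n + 1))} {a : Fin (n + 1)}
    (b : Fin (n + 1)) (hab : a ≤ b) (h : (ofEdges (edges θ)).r a b) : θ.r a b := by
  induction b using Fin.induction with
  | zero => exact (Fin.le_zero_iff.1 hab) ▸ θ.refl _
  | succ i ih =>
    rcases hab.eq_or_lt with rfl | hlt
    · exact θ.refl _
    have hle : a ≤ i.castSucc := by
      simp only [Fin.lt_def, Fin.le_def, Fin.val_castSucc, Fin.val_succ] at hlt ⊢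
      omega
    have hi : i ∈ edges θ := by
      by_contra hi
      exact absurd ((h i hi).1 hle) (by simp [Fin.le_def])
    have hi' : i ∈ edges (ofEdges (edges θ)) := by rwa [edges_ofEdges]
    exact θ.trans (ih hle (LatCon.trans _ h (LatCon.symm _ hi'))) hi

theorem ofEdges_edges (θ : LatCon (Fin (n + 1))) : ofEdges (edges θ) = θ := by
  refine ext' fun a b => ⟨fun h => ?_, fun h i hi => ?_⟩
  · rcases le_total a b with hab | hab
    · exact r_of_ofEdges_edges_of_le b hab h
    · exact θ.symm (r_of_ofEdges_edges_of_le a hab (LatCon.symm _ h))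
  · by_contra hne
    by_cases ha : a ≤ i.castSucc
    · exact hi (mem_edges_of_r h ha fun hb => hne (iff_of_true ha hb))
    · exact hi (mem_edges_of_r (θ.symm h) (by tauto) ha)

/-- The congruence lattice of an `(n + 1)`-element chain is Boolean with `n` atoms. -/
def edgesIso (n : ℕ) : LatCon (Fin (n + 1)) ≃o Set (Fin n) where
  toFun := edges
  invFun := ofEdges
  left_inv := ofEdges_edges
  right_inv := edges_ofEdges
  map_rel_iff' {θ ψ} := by
    refine ⟨fun h => ?_, fun h i hi => h _ _ hi⟩
    rw [← ofEdges_edges θ, ← ofEdges_edges ψ]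
    exact fun a b hab i hi => hab i fun hi' => hi (h hi')

theorem edgesIso_princ (a b : Fin (n + 1)) :
    edgesIso n (princ a b) = {i | ¬ (a ≤ i.castSucc ↔ b ≤ i.castSucc)} := by
  have hr : (ofEdges (edges (princ a b))).r a b := by
    rw [ofEdges_edges]
    exact fun θ hθ => hθ
  refine Set.Subset.antisymm ?_ fun i hi => ?_
  · rw [← edges_ofEdges {i : Fin n | ¬ (a ≤ i.castSucc ↔ b ≤ i.castSucc)}]
    exact fun i hi => hi (ofEdges _) fun j hj => not_not.1 hj
  · by_contra hi'
    exact hi (hr i hi')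

end LatCon

/-- **Corollary 13.** A representable subset `Q` need not have `Q \ {⊤}` a down-set:
there are a finite distributive lattice `D` and a representable `Q ⊆ D` such that
`Q \ {⊤}` is not a lower set of `D`. -/
theorem representable_not_lower_set :
    ∃ (D : Type) (_ : DistribLattice D) (_ : Fintype D) (_ : BoundedOrder D)
      (Q : Set D), Representable D Q ∧ ¬ IsLowerSet (Q \ {⊤}) := by
  refine ⟨Set (Fin 4), inferInstance, inferInstance, inferInstance,
    LatCon.edgesIso 4 '' Princ (Fin 5),
    ⟨Fin 5, inferInstance, inferInstance, LatCon.edgesIso 4, rfl⟩, fun hlow => ?_⟩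
  have hmem : LatCon.edgesIso 4 (LatCon.princ 0 3) ∈
      (LatCon.edgesIso 4 '' Princ (Fin 5)) \ {⊤} := by
    refine ⟨⟨_, ⟨0, 3, rfl⟩, rfl⟩, fun h => ?_⟩
    rw [Set.mem_singleton_iff, LatCon.edgesIso_princ] at h
    have h3 : (3 : Fin 4) ∈ (⊤ : Set (Fin 4)) := trivial
    rw [← h, Set.mem_ofPred_eq] at h3
    revert h3
    decide
  have hle : {i : Fin 4 | i = 0 ∨ i = 2} ≤ LatCon.edgesIso 4 (LatCon.princ 0 3) := by
    rw [LatCon.edgesIso_princ]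
    rintro i (rfl | rfl) <;> rw [Set.mem_ofPred_eq] <;> decide
  obtain ⟨⟨_, ⟨a, b, rfl⟩, hab⟩, -⟩ := hlow hle hmem
  rw [LatCon.edgesIso_princ, Set.ext_iff] at hab
  simp only [Set.mem_ofPred_eq] at hab
  revert a b
  decide
end

section
/- Let D be a finite distributive lattice. If D is fully representable, then the set J(D) of join-irreducible elements of D contains no three-element antichain. (For finite distributive lattices, the absence of a three-element antichain in J(D) is equivalent to planarity, so this says every fully representable finite distributive lattice is planar.) -/
universe u


namespace LatCon

variable {L : Type*} [Lattice L]

theorem princ_inf_sup (a b : L) : princ (a ⊓ b) (a ⊔ b) = princ a b := by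
  apply le_antisymm
  · rw [princ_le_iff]
    have h : (princ a b).r a b := princ_le_iff.1 le_rfl
    have h1 := (princ a b).inf_comp h ((princ a b).refl b)
    have h2 := (princ a b).sup_comp h ((princ a b).refl b)
    rw [inf_idem] at h1
    rw [sup_idem] at h2
    exact (princ a b).trans h1 ((princ a b).symm h2)
  · rw [princ_le_iff]
    have h : (princ (a ⊓ b) (a ⊔ b)).r (a ⊓ b) (a ⊔ b) := princ_le_iff.1 le_rfl
    generalize princ (a ⊓ b) (a ⊔ b) = θ at h ⊢
    have h1 := θ.sup_comp h (θ.refl a)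
    have h2 := θ.sup_comp h (θ.refl b)
    rw [sup_comm _ a, sup_inf_self, sup_eq_left.2 le_sup_left] at h1
    rw [inf_comm, sup_comm _ b, sup_inf_self, sup_eq_left.2 le_sup_right] at h2
    exact θ.trans h1 (θ.symm h2)

theorem princ_le_princ_sup_princ (x z y : L) : princ x y ≤ princ x z ⊔ princ z y :=
  princ_le_iff.2 <| (princ x z ⊔ princ z y).trans
    (princ_le_iff.1 le_sup_left) (princ_le_iff.1 le_sup_right)

theorem princ_le_princ {x y a b : L} (hxa : x ≤ a) (hab : a ≤ b) (hby : b ≤ y) :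
    princ a b ≤ princ x y := by
  rw [princ_le_iff]
  have h : (princ x y).r x y := princ_le_iff.1 le_rfl
  have h1 := (princ x y).inf_comp ((princ x y).sup_comp h ((princ x y).refl a))
    ((princ x y).refl b)
  rwa [sup_eq_right.2 hxa, inf_eq_left.2 hab,
    sup_eq_left.2 (hab.trans hby), inf_eq_right.2 hby] at h1

/-- The transitive closure of the union of two congruences. -/
def transGenUnion (α β : LatCon L) : LatCon L where
  r := Relation.ReflTransGen fun a b => α.r a b ∨ β.r a b
  refl _ := .refl
  symm h := by
    induction h with
    | refl => exact .refl
    | tail _ h ih => exact .head (h.imp α.symm β.symm) ih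
  trans h h' := h.trans h'
  sup_comp {a b c d} h h' :=
    .trans
      (h.lift (· ⊔ c) fun _ _ hs =>
        hs.imp (α.sup_comp · (α.refl c)) (β.sup_comp · (β.refl c)))
      (h'.lift (b ⊔ ·) fun _ _ hs =>
        hs.imp (α.sup_comp (α.refl b) ·) (β.sup_comp (β.refl b) ·))
  inf_comp {a b c d} h h' :=
    .trans
      (h.lift (· ⊓ c) fun _ _ hs =>
        hs.imp (α.inf_comp · (α.refl c)) (β.inf_comp · (β.refl c)))
      (h'.lift (b ⊓ ·) fun _ _ hs =>
        hs.imp (α.inf_comp (α.refl b) ·) (β.inf_comp (β.refl b) ·))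

theorem sup_le_transGenUnion (α β : LatCon L) : α ⊔ β ≤ transGenUnion α β :=
  sup_le (fun _ _ h => .single (.inl h)) (fun _ _ h => .single (.inr h))

/-- In a finite lattice, every nonzero principal congruence is generated by an interval which is
either prime or is cut by some point into two intervals generating smaller congruences. -/
theorem exists_covBy_or_split [Finite L] (a b : L) (hab : princ a b ≠ ⊥) :
    ∃ x y : L, princ x y = princ a b ∧ (x ⋖ y ∨ ∃ z, princ x z < princ a b ∧
      princ z y < princ a b) := by
  obtain ⟨x, ⟨y₀, hxy₀, hx⟩, hxmax⟩ :=
    (Set.toFinite {x : L | ∃ y, x ≤ y ∧ princ x y = princ a b}).exists_maximal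
      ⟨a ⊓ b, a ⊔ b, inf_le_sup, princ_inf_sup a b⟩
  obtain ⟨y, ⟨hxy, hy⟩, hymin⟩ :=
    (Set.toFinite {y : L | x ≤ y ∧ princ x y = princ a b}).exists_minimal ⟨y₀, hxy₀, hx⟩
  refine ⟨x, y, hy, or_iff_not_imp_left.2 fun hcov => ?_⟩
  have hlt : x < y := by
    refine lt_of_le_of_ne hxy ?_
    rintro rfl
    exact hab (le_bot_iff.1 (hy ▸ princ_le_iff.2 (LatCon.refl _ _)))
  obtain ⟨z, hxz, hzy⟩ := (not_covBy_iff hlt).1 hcov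
  refine ⟨z, lt_of_le_of_ne ?_ fun h => ?_, lt_of_le_of_ne ?_ fun h => ?_⟩
  · exact hy ▸ princ_le_princ le_rfl hxz.le hzy.le
  · exact hzy.not_ge (hymin ⟨hxz.le, h⟩ hzy.le)
  · exact hy ▸ princ_le_princ hxz.le hzy.le le_rfl
  · exact hxz.not_ge (hxmax ⟨y, hzy.le, h⟩ hxz.le)

end LatCon

/-- **Theorem 14.** If a finite distributive lattice `D` is fully representable, then
`J(D)` contains no three-element antichain (equivalently, `D` is planar). -/
theorem fullyRepresentable_no_three_antichain
    (D : Type*) [DistribLattice D] [Fintype D] [BoundedOrder D]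
    (hD : FullyRepresentable D) :
    ¬ ∃ a0 a1 a2 : D, SupIrred a0 ∧ SupIrred a1 ∧ SupIrred a2 ∧
      ¬ a0 ≤ a1 ∧ ¬ a1 ≤ a0 ∧ ¬ a0 ≤ a2 ∧ ¬ a2 ≤ a0 ∧ ¬ a1 ≤ a2 ∧ ¬ a2 ≤ a1 := by
  rintro ⟨a0, a1, a2, h0, h1, h2, h01, h10, h02, h20, h12, h21⟩
  obtain ⟨L, _, _, φ, hφ⟩ := hD (Jplus D ∪ {a0 ⊔ a1 ⊔ a2}) Set.subset_union_left
  have hle {d : D} (hd : d ∈ Jplus D ∪ {a0 ⊔ a1 ⊔ a2}) (hlt : d < a0 ⊔ a1 ⊔ a2) :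
      d ≤ a0 ∨ d ≤ a1 ∨ d ≤ a2 := by
    rcases hd with ((rfl | rfl) | hd) | rfl
    · exact .inl bot_le
    · exact (not_top_lt hlt).elim
    · simpa only [hd.supPrime.le_sup, or_assoc] using hlt.le
    · exact (lt_irrefl _ hlt).elim
  have hprinc (x y : L) : φ (.princ x y) ∈ Jplus D ∪ {a0 ⊔ a1 ⊔ a2} :=
    hφ ▸ ⟨_, ⟨x, y, rfl⟩, rfl⟩
  obtain ⟨_, ⟨a, b, rfl⟩, hab⟩ : a0 ⊔ a1 ⊔ a2 ∈ φ '' Princ L := hφ ▸ .inr rfl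
  have hne : LatCon.princ a b ≠ ⊥ := by
    intro h
    rw [h, φ.map_bot] at hab
    exact h0.ne_bot (le_bot_iff.1 (hab ▸ le_sup_left.trans le_sup_left))
  obtain ⟨x, y, hxy, hcov | ⟨z, hxz, hzy⟩⟩ := LatCon.exists_covBy_or_split a b hne
  · have hr : (φ.symm a0 ⊔ φ.symm a1 ⊔ φ.symm a2).r x y := by
      rw [← map_sup, ← map_sup, ← hab, φ.symm_apply_apply, ← hxy]
      exact LatCon.princ_le_iff.1 le_rfl
    have hcases : a0 ⊔ a1 ⊔ a2 ≤ a0 ∨ a0 ⊔ a1 ⊔ a2 ≤ a1 ∨ a0 ⊔ a1 ⊔ a2 ≤ a2 := by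
      have hto {d : D} (h : (φ.symm d).r x y) : a0 ⊔ a1 ⊔ a2 ≤ d := by
        rw [← hab, ← hxy, ← φ.le_symm_apply]
        exact LatCon.princ_le_iff.2 h
      exact or_assoc.1 ((LatCon.r_or_r_of_covBy hcov hr).imp
        (fun h => (LatCon.r_or_r_of_covBy hcov h).imp hto hto) hto)
    simp only [sup_le_iff] at hcases
    tauto
  · have hsup : a0 ⊔ a1 ⊔ a2 ≤ φ (.princ x z) ⊔ φ (.princ z y) := by
      rw [← hab, ← map_sup, ← hxy]
      exact φ.monotone (LatCon.princ_le_princ_sup_princ x z y)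
    have hxz' := hle (hprinc x z) (hab ▸ φ.strictMono hxz)
    have hzy' := hle (hprinc z y) (hab ▸ φ.strictMono hzy)
    simp only [sup_le_iff, h0.supPrime.le_sup, h1.supPrime.le_sup, h2.supPrime.le_sup] at hsup
    obtain ⟨⟨hs0, hs1⟩, hs2⟩ := hsup
    have hsep {d : D} (hd : d ≤ a0 ∨ d ≤ a1 ∨ d ≤ a2) :
        ¬ (a0 ≤ d ∧ a1 ≤ d) ∧ ¬ (a0 ≤ d ∧ a2 ≤ d) ∧ ¬ (a1 ≤ d ∧ a2 ≤ d) := by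
      have := @le_trans D _
      grind
    have hsep_xz := hsep hxz'
    have hsep_zy := hsep hzy'
    clear hsep hxz' hzy'
    grind only
end

section
/- Let D = C₃ × C₃ be the direct product of two three-element chains (a 9-element planar distributive lattice), whose join-irreducible elements are a = (1,0), b = (2,0), c = (0,1), d = (0,2), and let e = a ⊔ c = (1,1). Then the subset Q = {⊥, a, b, c, d, e, ⊤} = J⁺(D) ∪ {e} is not principal congruence representable; consequently, D is not fully representable. -/
universe u


namespace LatCon

variable {L : Type*} [Lattice L]

theorem r_of_le_of_le (θ : LatCon L) {a b u v : L} (hau : a ≤ u) (huv : u ≤ v) (hvb : v ≤ b)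
    (h : θ.r a b) : θ.r u v := by
  have h1 := θ.inf_comp (θ.sup_comp h (θ.refl u)) (θ.refl v)
  rwa [sup_eq_right.2 hau, inf_eq_left.2 huv, sup_eq_left.2 (huv.trans hvb),
    inf_eq_right.2 hvb] at h1

theorem princ_sup_princ_s18 {a b c : L} (hab : a ≤ b) (hbc : b ≤ c) :
    princ a b ⊔ princ b c = princ a c := by
  have h : (princ a c).r a c := princ_le_iff.1 le_rfl
  refine le_antisymm (sup_le (princ_le_iff.2 (r_of_le_of_le _ le_rfl hab hbc h))
    (princ_le_iff.2 (r_of_le_of_le _ hab hbc le_rfl h))) (princ_le_iff.2 ?_)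
  exact (princ a b ⊔ princ b c).trans (princ_le_iff.1 le_sup_left) (princ_le_iff.1 le_sup_right)

/-- The congruence generated by the union of two congruences, as a transitive closure. -/
def unionClosure (θ ψ : LatCon L) : LatCon L where
  r := Relation.EqvGen fun a b => θ.r a b ∨ ψ.r a b
  refl := Relation.EqvGen.refl
  symm := fun h => h.symm
  trans := fun h h' => h.trans _ _ _ h'
  sup_comp := by
    have key : ∀ {a b : L} (c : L), Relation.EqvGen (fun a b => θ.r a b ∨ ψ.r a b) a b →
        Relation.EqvGen (fun a b => θ.r a b ∨ ψ.r a b) (a ⊔ c) (b ⊔ c) := by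
      intro a b c h
      induction h with
      | rel a b h =>
        exact .rel _ _ (h.imp (θ.sup_comp · (θ.refl c)) (ψ.sup_comp · (ψ.refl c)))
      | refl a => exact .refl _
      | symm a b _ ih => exact ih.symm
      | trans a b d _ _ ih ih' => exact ih.trans _ _ _ ih'
    intro a b c d h h'
    refine (key c h).trans _ _ _ ?_
    rw [sup_comm b c, sup_comm b d]
    exact key b h'
  inf_comp := by
    have key : ∀ {a b : L} (c : L), Relation.EqvGen (fun a b => θ.r a b ∨ ψ.r a b) a b →
        Relation.EqvGen (fun a b => θ.r a b ∨ ψ.r a b) (a ⊓ c) (b ⊓ c) := by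
      intro a b c h
      induction h with
      | rel a b h =>
        exact .rel _ _ (h.imp (θ.inf_comp · (θ.refl c)) (ψ.inf_comp · (ψ.refl c)))
      | refl a => exact .refl _
      | symm a b _ ih => exact ih.symm
      | trans a b d _ _ ih ih' => exact ih.trans _ _ _ ih'
    intro a b c d h h'
    refine (key c h).trans _ _ _ ?_
    rw [inf_comm b c, inf_comm b d]
    exact key b h'

theorem sup_le_unionClosure (θ ψ : LatCon L) : θ ⊔ ψ ≤ unionClosure θ ψ :=
  sup_le (fun _ _ h => .rel _ _ (.inl h)) (fun _ _ h => .rel _ _ (.inr h))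

/-- A congruence that collapses a covering pair into a join collapses it in one of the joinands. -/
theorem r_or_r_of_covBy_s18 {u v : L} (huv : u ⋖ v) {θ ψ : LatCon L} (h : (θ ⊔ ψ).r u v) :
    θ.r u v ∨ ψ.r u v := by
  by_contra! hn
  have step : ∀ (χ : LatCon L) {a b : L}, ¬ χ.r u v → χ.r a b → (a ⊔ u) ⊓ v = (b ⊔ u) ⊓ v := by
    intro χ a b hχ hab
    have h1 := χ.inf_comp (χ.sup_comp hab (χ.refl u)) (χ.refl v)
    have two : ∀ z : L, (z ⊔ u) ⊓ v = u ∨ (z ⊔ u) ⊓ v = v := fun z =>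
      huv.eq_or_eq (le_inf le_sup_right huv.le) inf_le_right
    rcases two a with ha | ha <;> rcases two b with hb | hb <;> rw [ha, hb] at h1 ⊢
    · exact absurd h1 hχ
    · exact absurd (χ.symm h1) hχ
  have const : ∀ {a b : L}, (unionClosure θ ψ).r a b → (a ⊔ u) ⊓ v = (b ⊔ u) ⊓ v := by
    intro a b hab
    induction hab with
    | rel a b h => exact h.elim (step θ hn.1) (step ψ hn.2)
    | refl a => rfl
    | symm a b _ ih => exact ih.symm
    | trans a b c _ _ ih ih' => exact ih.trans ih'
  have huv' := const (sup_le_unionClosure θ ψ u v h)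
  rw [sup_idem, inf_eq_left.2 huv.le, sup_eq_left.2 huv.le, inf_idem] at huv'
  exact huv.ne huv'

/-- In a finite lattice, if a principal congruence `ε` absorbs every `princ u v` with `u ⋖ v` for
which `ε ⊔ princ u v` is principal, then `ε` is the top congruence. -/
theorem eq_top_of_princ_sup_covBy [Finite L] {ε : LatCon L} (hε : ε.IsPrincipal)
    (hext : ∀ u v : L, u ⋖ v → (ε ⊔ princ u v).IsPrincipal → princ u v ≤ ε) : ε = ⊤ := by
  obtain ⟨x, y, rfl⟩ := hε
  generalize hε : princ x y = ε at *
  have up : ∀ u v w : L, u ≤ v → princ u v = ε → v ⋖ w → princ u w = ε := by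
    intro u v w huv h hvw
    have hs := princ_sup_princ_s18 huv hvw.le
    rw [h] at hs
    rw [← hs]
    exact sup_eq_left.2 (hext v w hvw ⟨u, w, hs⟩)
  have down : ∀ u v w : L, u ≤ v → princ u v = ε → w ⋖ u → princ w v = ε := by
    intro u v w huv h hwu
    have hs := princ_sup_princ_s18 hwu.le huv
    rw [h, sup_comm] at hs
    rw [← hs]
    exact sup_eq_left.2 (hext w u hwu ⟨w, v, hs⟩)
  obtain ⟨t, -, ht⟩ := Set.Finite.exists_le_maximal
    (Set.toFinite {t : L | x ⊓ y ≤ t ∧ princ (x ⊓ y) t = ε})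
    (a := x ⊔ y) ⟨inf_le_sup, (princ_inf_sup x y).trans hε⟩
  have htop : IsMax t := by
    by_contra hmax
    obtain ⟨w, hw⟩ := exists_covBy_of_wellFoundedLT hmax
    exact hw.lt.not_ge (ht.2 ⟨ht.1.1.trans hw.le, up _ _ _ ht.1.1 ht.1.2 hw⟩ hw.le)
  obtain ⟨s, -, hs⟩ := Set.Finite.exists_le_minimal
    (Set.toFinite {s : L | s ≤ t ∧ princ s t = ε}) (a := x ⊓ y) ht.1
  have hbot : IsMin s := by
    by_contra hmin
    obtain ⟨w, hw⟩ := exists_covBy_of_wellFoundedGT hmin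
    exact hw.lt.not_ge (hs.2 ⟨hw.le.trans hs.1.1, down _ _ _ hs.1.1 hs.1.2 hw⟩ hw.le)
  have hst : ε.r s t := princ_le_iff.1 hs.1.2.le
  have hle : ∀ z, s ≤ z := fun z => (hbot inf_le_left : s ≤ s ⊓ z).trans inf_le_right
  have hge : ∀ z, z ≤ t := fun z => le_sup_right.trans (htop le_sup_left : t ⊔ z ≤ t)
  refine top_unique fun a b _ => ?_
  exact ε.trans (ε.symm (ε.r_of_le_of_le le_rfl (hle a) (hge a) hst))
    (ε.r_of_le_of_le le_rfl (hle b) (hge b) hst)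

end LatCon

/-- **Theorem 15.** In the nine-element planar distributive lattice `D = C₃ × C₃`
(`C₃` the three-element chain), with join-irreducible elements `a = (1,0)`, `b = (2,0)`,
`c = (0,1)`, `d = (0,2)` and `e = a ⊔ c = (1,1)`, the candidate
`Q = {⊥, a, b, c, d, e, ⊤} = J⁺(D) ∪ {e}` is not representable; hence `D` is not fully
representable. -/
theorem C3_sq_not_fullyRepresentable :
    ¬ Representable (Fin 3 × Fin 3)
        ({⊥, ((1 : Fin 3), (0 : Fin 3)), ((2 : Fin 3), (0 : Fin 3)),
          ((0 : Fin 3), (1 : Fin 3)), ((0 : Fin 3), (2 : Fin 3)),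
          ((1 : Fin 3), (1 : Fin 3)), ⊤} : Set (Fin 3 × Fin 3)) ∧
    ({⊥, ((1 : Fin 3), (0 : Fin 3)), ((2 : Fin 3), (0 : Fin 3)),
          ((0 : Fin 3), (1 : Fin 3)), ((0 : Fin 3), (2 : Fin 3)),
          ((1 : Fin 3), (1 : Fin 3)), ⊤} : Set (Fin 3 × Fin 3)) =
      Jplus (Fin 3 × Fin 3) ∪ {((1 : Fin 3), (1 : Fin 3))} ∧
    ¬ FullyRepresentable (Fin 3 × Fin 3) := by
  have hnot : ¬ Representable (Fin 3 × Fin 3)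
      ({⊥, ((1 : Fin 3), (0 : Fin 3)), ((2 : Fin 3), (0 : Fin 3)),
        ((0 : Fin 3), (1 : Fin 3)), ((0 : Fin 3), (2 : Fin 3)),
        ((1 : Fin 3), (1 : Fin 3)), ⊤} : Set (Fin 3 × Fin 3)) := by
    rintro ⟨L, _, _, φ, hφ⟩
    have he : (φ.symm (1, 1)).IsPrincipal := by
      obtain ⟨θ, hθ, hθe⟩ : ((1 : Fin 3), (1 : Fin 3)) ∈ φ '' Princ L := by
        rw [hφ]
        simp
      rwa [← hθe, φ.symm_apply_apply]
    refine absurd (LatCon.eq_top_of_princ_sup_covBy he fun u v huv hsup => ?_) ?_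
    · have hQ := hφ ▸ Set.mem_image_of_mem φ hsup
      rw [map_sup, φ.apply_symm_apply] at hQ
      have hJ : φ (LatCon.princ u v) ≤ (2, 0) ∨ φ (LatCon.princ u v) ≤ (0, 2) := by
        have htop : φ.symm (2, 0) ⊔ φ.symm (0, 2) = ⊤ := by
          rw [← map_sup, ← map_top φ.symm]
          rfl
        have hr : (φ.symm (2, 0) ⊔ φ.symm (0, 2)).r u v :=
          LatCon.princ_le_iff.1 (htop ▸ le_top)
        simpa only [← LatCon.princ_le_iff, ← φ.le_symm_apply] using
          LatCon.r_or_r_of_covBy_s18 huv hr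
      rw [φ.le_symm_apply]
      generalize φ (LatCon.princ u v) = w at hQ hJ
      simp only [Set.mem_insert_iff, Set.mem_singleton_iff] at hQ
      revert w
      decide
    · rw [← map_top φ.symm, φ.symm.injective.eq_iff]
      decide
  have hQ : ({⊥, ((1 : Fin 3), (0 : Fin 3)), ((2 : Fin 3), (0 : Fin 3)),
        ((0 : Fin 3), (1 : Fin 3)), ((0 : Fin 3), (2 : Fin 3)),
        ((1 : Fin 3), (1 : Fin 3)), ⊤} : Set (Fin 3 × Fin 3)) =
      Jplus (Fin 3 × Fin 3) ∪ {((1 : Fin 3), (1 : Fin 3))} := by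
    ext w
    simp only [Jplus, Set.mem_union, Set.mem_insert_iff, Set.mem_singleton_iff, Set.mem_ofPred_eq,
      SupIrred, IsMin]
    revert w
    decide
  exact ⟨hnot, hQ, fun hfull => hnot (hfull _ (hQ ▸ Set.subset_union_left))⟩
end
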